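/- arXiv:1009.0148 — 5 statements merged into one kernel-verified Lean document; each statement's English description precedes it below -/
import Mathlib

section
/- Let F be a field of characteristic zero and Ω an extension field of F. Let ȳ_1,…,ȳ_n ∈ Ω and let u_1,…,u_r ∈ Ω be algebraically independent over the subfield F(ȳ_1,…,ȳ_n). Let P_1,…,P_m ∈ F[U_1,…,U_r,Y_1,…,Y_n] be polynomials. If the elements P_1(u,ȳ),…,P_m(u,ȳ) of Ω are algebraically dependent over F(u_1,…,u_r), then for every choice of v_1,…,v_r ∈ F, the elements P_1(v,ȳ),…,P_m(v,ȳ) are algebraically dependent over F. -/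
open MvPolynomial in
/-- If the constant coefficient of `φ : A → B[σ]` is injective, then so is the extension of `φ`
to `A[σ]` fixing the variables. -/
theorem MvPolynomial.eval₂Hom_X_injective_of_constantCoeff {σ A B : Type*} [CommRing A]
    [CommRing B] (φ : A →+* MvPolynomial σ B)
    (hφ : Function.Injective ((constantCoeff : MvPolynomial σ B →+* B).comp φ)) :
    Function.Injective (eval₂Hom φ (X : σ → MvPolynomial σ B)) := by
  classical
  rw [injective_iff_map_eq_zero]
  intro p hp
  by_contra hne
  obtain ⟨s, hs⟩ := p.support.exists_minimal (support_nonempty.mpr hne)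
  have hmon (t : σ →₀ ℕ) : ∏ i ∈ t.support, (X i : MvPolynomial σ B) ^ t i = monomial t 1 := by
    rw [monomial_eq, C_1, one_mul, Finsupp.prod]
  have hcoeff : coeff s (eval₂Hom φ X p) = constantCoeff (φ (coeff s p)) := by
    rw [coe_eval₂Hom, eval₂_eq, coeff_sum, Finset.sum_eq_single_of_mem s hs.prop]
    · rw [hmon, coeff_mul_monomial', if_pos le_rfl, mul_one, tsub_self, constantCoeff_eq]
    · intro t ht hts
      rw [hmon, coeff_mul_monomial', if_neg fun hle => hts (le_antisymm hle (hs.le_of_le ht hle))]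
  rw [hp, coeff_zero] at hcoeff
  refine mem_support_iff.mp hs.prop (hφ ?_)
  simpa using hcoeff.symm

open MvPolynomial in
/-- Polynomials whose constant coefficients are algebraically independent over `F` are, together
with the variables, algebraically independent over `F`. -/
theorem AlgebraicIndependent.sumElim_X_of_constantCoeff {σ ι F K : Type*} [CommRing F]
    [CommRing K] [Algebra F K] (p : ι → MvPolynomial σ K)
    (hp : AlgebraicIndependent F fun i => constantCoeff (p i)) :
    AlgebraicIndependent F (Sum.elim X p) := by
  have hinj := eval₂Hom_X_injective_of_constantCoeff (aeval (R := F) p).toRingHom (by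
    have h : (constantCoeff : MvPolynomial σ K →+* K).comp (aeval (R := F) p).toRingHom =
        (aeval (R := F) fun i => constantCoeff (p i)).toRingHom := by
      ext <;> simp [MvPolynomial.algebraMap_apply]
    rw [h]
    exact hp)
  have hcomp : (aeval (R := F) (Sum.elim X p)).toRingHom =
      (eval₂Hom (aeval (R := F) p).toRingHom (X : σ → MvPolynomial σ K)).comp
        (sumAlgEquiv F σ ι).toRingEquiv.toRingHom := by
    ext x
    · simp
    · cases x <;> simp
  have := hinj.comp (sumAlgEquiv F σ ι).injective
  intro a b hab
  refine this ?_
  have ha := congrArg (fun f => f a) hcomp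
  have hb := congrArg (fun f => f b) hcomp
  exact ha.symm.trans (hab.trans hb)

open MvPolynomial in
/-- Translating by constants preserves algebraic independence. -/
theorem AlgebraicIndependent.sub_algebraMap {ι K A : Type*} [CommRing K] [CommRing A]
    [Algebra K A] {x : ι → A} (hx : AlgebraicIndependent K x) (c : ι → K) :
    AlgebraicIndependent K fun i => x i - algebraMap K A (c i) := by
  have hcomp : aeval (R := K) (fun i => x i - algebraMap K A (c i)) =
      (aeval x).comp (aeval (R := K) fun i => (X i - C (c i) : MvPolynomial ι K)) := by
    ext; simp
  have hinv : (aeval (R := K) fun i => (X i + C (c i) : MvPolynomial ι K)).comp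
      (aeval (R := K) fun i => (X i - C (c i) : MvPolynomial ι K)) = AlgHom.id K _ := by
    ext; simp
  have hinj : Function.Injective
      (aeval (R := K) fun i => (X i - C (c i) : MvPolynomial ι K)) := by
    intro a b hab
    have h := congrArg (aeval (R := K) fun i => (X i + C (c i) : MvPolynomial ι K)) hab
    rwa [← AlgHom.comp_apply, ← AlgHom.comp_apply, hinv] at h
  rw [AlgebraicIndependent, hcomp, AlgHom.coe_comp]
  exact Function.Injective.comp hx hinj


/-- **Algebraic specialization of dependence** (Lemma on algebraic specializations).
Let `F` be a field of characteristic zero and `Ω` an extension field of `F`.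
Let `ȳ₁,…,ȳₙ ∈ Ω` and `u₁,…,u_r ∈ Ω` be algebraically independent over `F(ȳ₁,…,ȳₙ)`.
Let `P₁,…,P_m ∈ F[U₁,…,U_r,Y₁,…,Yₙ]`.  If `P₁(u,ȳ),…,P_m(u,ȳ)` are algebraically
dependent over `F(u₁,…,u_r)`, then for every `v₁,…,v_r ∈ F`, the elements
`P₁(v,ȳ),…,P_m(v,ȳ)` are algebraically dependent over `F`. -/
theorem algebraic_specialization_of_dependence
    {F Ω : Type*} [Field F] [Field Ω] [CharZero F] [Algebra F Ω]
    (r n m : ℕ) (ybar : Fin n → Ω) (u : Fin r → Ω)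
    (hu : AlgebraicIndependent (↥(IntermediateField.adjoin F (Set.range ybar))) u)
    (P : Fin m → MvPolynomial (Fin r ⊕ Fin n) F)
    (hdep : ¬ AlgebraicIndependent (↥(IntermediateField.adjoin F (Set.range u)))
      (fun i => MvPolynomial.aeval (Sum.elim u ybar) (P i)))
    (v : Fin r → F) :
    ¬ AlgebraicIndependent F
      (fun i => MvPolynomial.aeval (Sum.elim (fun j => algebraMap F Ω (v j)) ybar) (P i)) := by
  intro hv
  apply hdep
  set K := IntermediateField.adjoin F (Set.range ybar)
  set y : Fin n → K := fun i => ⟨ybar i, IntermediateField.subset_adjoin F _ ⟨i, rfl⟩⟩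
  set u' : Fin r → Ω := fun j => u j - algebraMap F Ω (v j)
  have hu' : AlgebraicIndependent K u' := hu.sub_algebraMap fun j => algebraMap F K (v j)
  let p : Fin m → MvPolynomial (Fin r) K := fun i => MvPolynomial.aeval
    (Sum.elim (fun j => MvPolynomial.X j + MvPolynomial.C (algebraMap F K (v j)))
      (fun j => MvPolynomial.C (y j))) (P i)
  have hp : AlgebraicIndependent F fun i => MvPolynomial.constantCoeff (p i) := by
    refine AlgebraicIndependent.of_comp K.val ?_
    convert hv using 1
    funext i
    let f : MvPolynomial (Fin r) K →ₐ[F] K :=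
      (MvPolynomial.aeval (R := K) fun _ => (0 : K)).restrictScalars F
    have hf : ∀ q, MvPolynomial.constantCoeff q = f q := fun q => by
      simp [f, MvPolynomial.aeval_def, MvPolynomial.eval₂_zero'_apply]
    simp only [Function.comp_apply, hf, p]
    rw [← AlgHom.comp_apply, MvPolynomial.comp_aeval_apply]
    congr 2
    funext j
    cases j <;> simp [f, y]
  let g : MvPolynomial (Fin r) K →ₐ[F] Ω := (MvPolynomial.aeval (R := K) u').restrictScalars F
  have hg : Function.Injective g := hu'
  have hgp : ∀ i, g (p i) = MvPolynomial.aeval (Sum.elim u ybar) (P i) := by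
    intro i
    simp only [p]
    rw [MvPolynomial.comp_aeval_apply]
    congr 2
    funext j
    cases j
    · simp [g, u', ← IsScalarTower.algebraMap_apply]
    · simp [g, y]
  have hsum := (AlgebraicIndependent.sumElim_X_of_constantCoeff p hp).map' hg
  have hswap : AlgebraicIndependent F
      (Sum.elim (fun i => MvPolynomial.aeval (Sum.elim u ybar) (P i)) u') := by
    convert hsum.comp Sum.swap Sum.swap_leftInverse.injective using 1
    funext j
    cases j
    · simp [hgp]
    · simp [g]
  have hadj : IntermediateField.adjoin F (Set.range u') =
      IntermediateField.adjoin F (Set.range u) := by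
    apply le_antisymm <;> rw [IntermediateField.adjoin_le_iff] <;> rintro _ ⟨j, rfl⟩
    · exact sub_mem (IntermediateField.subset_adjoin F _ ⟨j, rfl⟩)
        (IntermediateField.algebraMap_mem _ _)
    · have h := add_mem (IntermediateField.subset_adjoin F (Set.range u') ⟨j, rfl⟩)
        (IntermediateField.algebraMap_mem (IntermediateField.adjoin F (Set.range u')) (v j))
      simpa [u'] using h
  have hfin := IntermediateField.algebraicIndependent_adjoin_iff.mpr
    (AlgebraicIndependent.sumElim_iff.mp hswap).2
  rwa [hadj] at hfin
end

section
/- Let F be an ordinary differential field of characteristic zero, E a differential field extension of F, and r a natural number. Let G be a nonzero differential polynomial over F in one differential variable u of order at most r, i.e., a nonzero polynomial in the algebraic indeterminates u^{(0)}, u^{(1)}, …, u^{(r)} with coefficients in F. Let η ∈ F satisfy δ(η) ≠ 0, and let a_0, a_1, …, a_r ∈ E be constants (δ(a_i) = 0 for all i) that are algebraically independent over F. Then G does not vanish at w = a_0 + a_1η + a_2η² + ⋯ + a_rη^r; that is, substituting δ^k(w) for u^{(k)} (0 ≤ k ≤ r) in G yields a nonzero element of E. -/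
/-- For `k` applications of a derivation to `p ^ (n + k)`, the leading term modulo `p ^ (n + 1)`
is a nonzero natural multiple of `p ^ n * (D p) ^ k`. -/
theorem Derivation.exists_iterate_pow_eq {S R : Type*} [CommRing S] [CommRing R] [Algebra S R]
    (D : Derivation S R R) (p : R)
    (k : ℕ) : ∀ n : ℕ, ∃ N : ℕ, N ≠ 0 ∧ ∃ q : R,
      D^[k] (p ^ (n + k)) = p ^ n * (N * D p ^ k + p * q) := by
  induction k with
  | zero => exact fun n => ⟨1, one_ne_zero, 0, by simp⟩
  | succ k ih =>
    intro n
    obtain ⟨N, hN, q, hq⟩ := ih (n + 1)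
    refine ⟨(n + 1) * N, mul_ne_zero n.succ_ne_zero hN,
      (n + 1) * D p * q + D (N * D p ^ k + p * q), ?_⟩
    rw [Function.iterate_succ_apply', show n + (k + 1) = n + 1 + k by ring, hq,
      Derivation.leibniz, Derivation.leibniz_pow]
    simp only [smul_eq_mul, nsmul_eq_mul, Nat.add_sub_cancel]
    push_cast
    ring

open Polynomial in
/-- A nonzero linear differential operator of order at most `r` does not annihilate all of
`1, η, …, η ^ r` when `δ η ≠ 0`. -/
theorem Derivation.eq_zero_of_sum_mul_iterate_pow_eq_zero {E : Type*} [Field E] [CharZero E]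
    (d : Derivation ℤ E E) {r : ℕ} {η : E} (hη : d η ≠ 0) (c : Fin (r + 1) → E)
    (hc : ∀ i : Fin (r + 1), ∑ k : Fin (r + 1), c k * d^[(k : ℕ)] (η ^ (i : ℕ)) = 0) :
    c = 0 := by
  classical
  by_contra hne
  obtain ⟨k₀, hk₀⟩ := Function.ne_iff.mp hne
  obtain ⟨m, hm, hmax⟩ := (Finset.univ.filter fun k => c k ≠ 0).exists_max_image
    (fun k => k) ⟨k₀, by simpa using hk₀⟩
  have hcm : c m ≠ 0 := by simpa using hm
  let _ : Differential E := ⟨d⟩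
  set D : Derivation ℤ E[X] E[X] := Differential.mapCoeffs
  set p : E[X] := C η - X
  have hDC : ∀ (k : ℕ) (x : E) (j : ℕ), D^[k] (C x * X ^ j) = C (d^[k] x) * X ^ j := by
    intro k x j
    induction k with
    | zero => rfl
    | succ k ih =>
      rw [Function.iterate_succ_apply', Function.iterate_succ_apply', ih,
        C_mul_X_pow_eq_monomial, C_mul_X_pow_eq_monomial, Differential.mapCoeffs_monomial]
      rfl
  have hDp : D p = C (d η) := by
    simp only [p, D, map_sub, Differential.mapCoeffs_C, Differential.mapCoeffs_X, sub_zero]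
    rfl
  have hsum : ∀ k : ℕ, (D^[k] (p ^ (m : ℕ))).eval η = ∑ i ∈ Finset.range (m + 1),
      d^[k] (η ^ i) * ((-1) ^ ((m : ℕ) - i) * ((m : ℕ).choose i) * η ^ ((m : ℕ) - i)) := by
    intro k
    have hp : p ^ (m : ℕ) = ∑ i ∈ Finset.range (m + 1),
        ((-1) ^ ((m : ℕ) - i) * ((m : ℕ).choose i : ℤ)) • (C (η ^ i) * X ^ ((m : ℕ) - i)) := by
      simp only [p, sub_eq_add_neg, add_pow]
      refine Finset.sum_congr rfl fun i _ => ?_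
      rw [neg_pow (X : E[X]), zsmul_eq_mul]
      push_cast
      rw [C_pow]
      ring
    have hit : (⇑D)^[k] = ⇑((D : E[X] →ₗ[ℤ] E[X]) ^ k) := by
      rw [Module.End.coe_pow]; rfl
    rw [hp, hit, map_sum, eval_finsetSum]
    refine Finset.sum_congr rfl fun i _ => ?_
    rw [map_zsmul, ← hit, hDC, zsmul_eq_mul]
    simp
    ring
  have hzero : ∑ k : Fin (r + 1), c k * (D^[(k : ℕ)] (p ^ (m : ℕ))).eval η = 0 := by
    simp only [hsum, Finset.mul_sum]
    rw [Finset.sum_comm]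
    refine Finset.sum_eq_zero fun i hi => ?_
    have hi' : i < r + 1 := by
      have := Finset.mem_range.mp hi
      omega
    simp only [← mul_assoc, ← Finset.sum_mul]
    rw [hc ⟨i, hi'⟩]
    simp
  have hpη : p.eval η = 0 := by simp [p]
  rw [Finset.sum_eq_single m] at hzero
  · obtain ⟨N, hN, q, hq⟩ := D.exists_iterate_pow_eq p m 0
    rw [zero_add] at hq
    rw [hq, hDp] at hzero
    simp [hpη, hcm, hN, hη] at hzero
  · intro k _ hk
    rcases lt_or_gt_of_ne hk with h | h
    · obtain ⟨N, -, q, hq⟩ := D.exists_iterate_pow_eq p k (m - k)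
      have hlt : (k : ℕ) < m := h
      rw [Nat.sub_add_cancel hlt.le] at hq
      rw [hq, eval_mul, eval_pow, hpη, zero_pow (Nat.sub_ne_zero_of_lt hlt)]
      simp
    · have : c k = 0 := by
        by_contra hck
        exact absurd (hmax k (by simpa using hck)) (not_le.mpr h)
      rw [this, zero_mul]
  · simp

/-- An invertible linear change of variables preserves algebraic independence. -/
theorem AlgebraicIndependent.sum_smul_of_isUnit_det {ι K A : Type*} [Fintype ι] [DecidableEq ι]
    [CommRing K] [CommRing A] [Algebra K A] {a : ι → A} (ha : AlgebraicIndependent K a)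
    (M : Matrix ι ι K) (hM : IsUnit M.det) :
    AlgebraicIndependent K fun k => ∑ i, M k i • a i := by
  rw [algebraicIndependent_iff] at ha ⊢
  intro G hG
  let f (N : Matrix ι ι K) (k : ι) : MvPolynomial ι K := ∑ i, N k i • MvPolynomial.X i
  have h : MvPolynomial.bind₁ (f M) G = 0 := by
    apply ha
    rw [MvPolynomial.aeval_bind₁]
    simpa [f] using hG
  have hinv : ∀ k, MvPolynomial.bind₁ (f M⁻¹) (f M k) = MvPolynomial.X k := by
    intro k
    have hmul : ∀ i, ∑ j, M k j * M⁻¹ j i = (1 : Matrix ι ι K) k i := fun i => by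
      rw [← Matrix.mul_nonsing_inv M hM, Matrix.mul_apply]
    simp only [f, map_sum, map_smul, MvPolynomial.bind₁_X_right, Finset.smul_sum, smul_smul]
    rw [Finset.sum_comm]
    simp [← Finset.sum_smul, hmul, Matrix.one_apply]
  have h' := congrArg (MvPolynomial.bind₁ (f M⁻¹)) h
  rw [MvPolynomial.bind₁_bind₁, map_zero] at h'
  simpa [hinv] using h'

/-- **Generic constant-combinations do not annul a nonzero differential polynomial.**
Let `E` be a differential field of characteristic zero with derivation `δ`, and `F` a
differential subfield (closed under `δ`).  Let `G` be a nonzero differential polynomial over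
`F` in one differential variable `u` of order at most `r` (a polynomial in the indeterminates
`u⁽⁰⁾,…,u⁽ʳ⁾` with coefficients in `F`).  Let `η ∈ F` with `δ η ≠ 0`, and let
`a₀,…,a_r ∈ E` be constants that are algebraically independent over `F`.  Then substituting
`δᵏ(a₀ + a₁η + ⋯ + a_rηʳ)` for `u⁽ᵏ⁾` in `G` yields a nonzero element of `E`. -/
theorem generic_constant_combination_not_annul
    {E : Type*} [Field E] [CharZero E] (δ : E → E)
    (hδadd : ∀ a b : E, δ (a + b) = δ a + δ b)
    (hδmul : ∀ a b : E, δ (a * b) = a * δ b + δ a * b)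
    (F : Subfield E) (hF : ∀ x ∈ F, δ x ∈ F)
    (r : ℕ) (G : MvPolynomial (Fin (r + 1)) F) (hG : G ≠ 0)
    (η : E) (hη : η ∈ F) (hη' : δ η ≠ 0)
    (a : Fin (r + 1) → E) (hconst : ∀ i, δ (a i) = 0)
    (hindep : AlgebraicIndependent F a) :
    MvPolynomial.aeval
      (fun k : Fin (r + 1) => δ^[(k : ℕ)] (∑ i : Fin (r + 1), a i * η ^ (i : ℕ))) G ≠ 0 := by
  let d : Derivation ℤ E E := Derivation.mk' (AddMonoidHom.mk' δ hδadd).toIntLinearMap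
    fun x y => by
      change δ (x * y) = x * δ y + y * δ x
      rw [hδmul, mul_comm y]
  have hd : ⇑d = δ := rfl
  have hmem : ∀ (k i : ℕ), δ^[k] (η ^ i) ∈ F := by
    intro k i
    induction k with
    | zero => exact pow_mem hη i
    | succ k ih =>
      rw [Function.iterate_succ_apply']
      exact hF _ ih
  let M : Matrix (Fin (r + 1)) (Fin (r + 1)) F := fun k i => ⟨δ^[k] (η ^ (i : ℕ)), hmem k i⟩
  have hM : M.det ≠ 0 := by
    intro hdet
    obtain ⟨c, hc, hcM⟩ := Matrix.exists_vecMul_eq_zero_iff.mpr hdet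
    refine hc (funext fun k => Subtype.ext ?_)
    refine congrFun (d.eq_zero_of_sum_mul_iterate_pow_eq_zero hη' (fun k => (c k : E)) ?_) k
    intro i
    have := congrArg (Subtype.val) (congrFun hcM i)
    simpa [Matrix.vecMul, dotProduct, M, hd] using this
  have hw : ∀ k : ℕ, δ^[k] (∑ i : Fin (r + 1), a i * η ^ (i : ℕ)) =
      ∑ i : Fin (r + 1), a i * δ^[k] (η ^ (i : ℕ)) := by
    intro k
    induction k with
    | zero => rfl
    | succ k ih =>
      rw [Function.iterate_succ_apply', ih, ← hd, map_sum]
      refine Finset.sum_congr rfl fun i _ => ?_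
      rw [hd, hδmul, hconst, zero_mul, add_zero, Function.iterate_succ_apply']
  have hind := hindep.sum_smul_of_isUnit_det M (isUnit_iff_ne_zero.mpr hM)
  intro h
  refine hG ((algebraicIndependent_iff.mp hind) G ?_)
  simpa [hw, M, Subfield.smul_def, mul_comm] using h
end

section
/- Let F be an ordinary differential field of characteristic zero, E a differential field extension of F, and ξ = (ξ_1,…,ξ_n) ∈ E^n of differential dimension d and order h over F. Call a subset U ⊆ {1,…,n} parametric for ξ if the family (ξ_i)_{i∈U} is differentially independent over F and, for every j ∉ U, the family (ξ_i)_{i∈U∪{j}} is differentially dependent over F; define the relative order of ξ with respect to such a U to be the transcendence degree of F⟨ξ_1,…,ξ_n⟩ over F⟨ξ_i : i ∈ U⟩. Then for every parametric subset U the relative order is finite and at most h, and there exists a parametric subset U whose relative order equals h. (Equivalently: the order of a prime differential ideal is the maximum of its relative orders over all parametric sets.) -/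
set_option synthInstance.maxHeartbeats 1000000
set_option maxHeartbeats 1000000

open Cardinal in
/-- The transcendence degree of an algebra `L` over `K`: the supremum of the
cardinalities of algebraically independent subsets of `L` over `K`. -/
noncomputable def Trdeg (K L : Type*) [CommRing K] [CommRing L] [Algebra K L] : Cardinal :=
  ⨆ s : { s : Set L // AlgebraicIndependent K ((↑) : s → L) }, #s.1

/-- A family `a : ι → E` is differentially independent over a subfield `K` of `E`
(w.r.t. a derivation `δ`) if the family of all its iterated derivatives is
algebraically independent over `K`. -/
def DiffIndep {E : Type*} [Field E] (δ : E → E) (K : Subfield E)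
    {ι : Type*} (a : ι → E) : Prop :=
  AlgebraicIndependent K (fun p : ι × ℕ => δ^[p.2] (a p.1))

/-- The differential subfield `F⟨S⟩` of `E` generated by `F` and `S`. -/
def diffAdjoin {E : Type*} [Field E] (δ : E → E) (F : Subfield E) (S : Set E) : Subfield E :=
  Subfield.closure (↑F ∪ {x | ∃ s ∈ S, ∃ k : ℕ, δ^[k] s = x})

/-- `ξ ∈ Eⁿ` has differential dimension `d` and order `h` over `F`: for all sufficiently
large `t`, the transcendence degree over `F` of `F(δʲξᵢ : 1 ≤ i ≤ n, 0 ≤ j ≤ t)`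
equals `d(t+1) + h`. -/
def HasDimOrder {E : Type*} [Field E] (δ : E → E) (F : Subfield E)
    {n : ℕ} (ξ : Fin n → E) (d h : ℕ) : Prop :=
  ∃ T : ℕ, ∀ t : ℕ, T ≤ t →
    Trdeg F (IntermediateField.adjoin F {x : E | ∃ i : Fin n, ∃ j ≤ t, δ^[j] (ξ i) = x})
      = ((d * (t + 1) + h : ℕ) : Cardinal)

/-- `U` is a parametric subset for `ξ` over `F`: `(ξᵢ)_{i∈U}` is differentially
independent over `F` and adjoining any further coordinate makes it differentially
dependent. -/
def IsParametric {E : Type*} [Field E] (δ : E → E) (F : Subfield E)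
    {n : ℕ} (ξ : Fin n → E) (U : Set (Fin n)) : Prop :=
  DiffIndep δ F (fun i : U => ξ i) ∧
    ∀ j ∉ U, ¬ DiffIndep δ F (fun i : ↥(insert j U) => ξ (i : Fin n))

/-- The relative order of `ξ` with respect to a subset `U`: the transcendence degree of
`F⟨ξ₁,…,ξₙ⟩` over `F⟨ξᵢ : i ∈ U⟩`. -/
noncomputable def relOrder {E : Type*} [Field E] (δ : E → E) (F : Subfield E)
    {n : ℕ} (ξ : Fin n → E) (U : Set (Fin n)) : Cardinal :=
  Trdeg (diffAdjoin δ F (ξ '' U))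
    (IntermediateField.adjoin (diffAdjoin δ F (ξ '' U))
      {x : E | ∃ i : Fin n, ∃ k : ℕ, δ^[k] (ξ i) = x})

section AlgebraicClosureOperator

variable {E : Type*} [Field E]

/-- The subfield of elements algebraic over the subfield generated by `S`. -/
noncomputable def acl (S : Set E) : Subfield E :=
  (algebraicClosure (Subfield.closure S) E).toSubfield

theorem mem_acl {S : Set E} {a : E} : a ∈ acl S ↔ IsAlgebraic (Subfield.closure S) a :=
  mem_algebraicClosure_iff

theorem IsAlgebraic.of_subfield_le {A B : Subfield E} (hAB : A ≤ B) {a : E}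
    (ha : IsAlgebraic A a) : IsAlgebraic B a := by
  let _ : Algebra A B := (Subfield.inclusion hAB).toAlgebra
  have : IsScalarTower A B E := IsScalarTower.of_algebraMap_eq fun _ => rfl
  exact ha.tower_top B

theorem closure_le_acl (S : Set E) : Subfield.closure S ≤ acl S := fun x hx =>
  mem_acl.2 (isAlgebraic_algebraMap (⟨x, hx⟩ : Subfield.closure S))

theorem subset_acl (S : Set E) : S ⊆ acl S :=
  Subfield.subset_closure.trans (closure_le_acl S)

theorem acl_le_of_subset {S T : Set E} (h : T ⊆ acl S) : acl T ≤ acl S := by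
  intro a ha
  have h1 : IsAlgebraic (acl S) a :=
    (mem_acl.1 ha).of_subfield_le (Subfield.closure_le.2 h)
  have h2 : IsAlgebraic (algebraicClosure (Subfield.closure S) E) a := h1
  exact mem_acl.2 (h2.restrictScalars (Subfield.closure S))

theorem acl_mono {S T : Set E} (h : S ⊆ T) : acl S ≤ acl T :=
  acl_le_of_subset (h.trans (subset_acl T))

theorem acl_closure_union (A S : Set E) :
    acl ((Subfield.closure A : Set E) ∪ S) = acl (A ∪ S) := by
  apply le_antisymm
  · apply acl_le_of_subset
    rintro x (hx | hx)
    · exact closure_le_acl _ (Subfield.closure_mono Set.subset_union_left hx)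
    · exact subset_acl _ (Or.inr hx)
  · exact acl_mono (Set.union_subset_union_left _ Subfield.subset_closure)

theorem mem_adjoin_iff_mem_closure {K : Subfield E} {S : Set E} {a : E} :
    a ∈ IntermediateField.adjoin K S ↔ a ∈ Subfield.closure ((K : Set E) ∪ S) := by
  rw [← IntermediateField.mem_toSubfield, IntermediateField.adjoin_toSubfield]
  have : Set.range (algebraMap K E) = K := Subtype.range_coe
  rw [this]

open scoped IntermediateField.algebraAdjoinAdjoin in
theorem isAlgebraic_adjoin_iff_mem_acl {K : Subfield E} {S : Set E} {a : E} :
    IsAlgebraic (Algebra.adjoin K S) a ↔ a ∈ acl ((K : Set E) ∪ S) := by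
  rw [IsFractionRing.isAlgebraic_iff (Algebra.adjoin K S) (IntermediateField.adjoin K S) E, mem_acl]
  have h : (IntermediateField.adjoin K S).toSubfield = Subfield.closure ((K : Set E) ∪ S) := by
    ext x; exact mem_adjoin_iff_mem_closure
  rw [← h]
  rfl

theorem AlgebraicIndependent.notMem_acl {K : Subfield E} {ι : Type*} {x : ι → E}
    (hx : AlgebraicIndependent K x) {s : Set ι} {i : ι} (hi : i ∉ s) :
    x i ∉ acl ((K : Set E) ∪ x '' s) := fun h =>
  hx.transcendental_adjoin hi (isAlgebraic_adjoin_iff_mem_acl.2 h)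

/-- A family none of whose members is algebraic over its predecessors is algebraically
independent. -/
theorem algebraicIndependent_of_forall_lt {K : Subfield E} {ι α : Type*} [LinearOrder α]
    {x : ι → E} (r : ι → α) (hr : Function.Injective r)
    (h : ∀ i, x i ∉ acl ((K : Set E) ∪ x '' {k | r k < r i})) : AlgebraicIndependent K x := by
  classical
  refine algebraicIndependent_of_finite_type fun t ht => ?_
  obtain ⟨t, rfl⟩ := ht.exists_finset_coe
  induction t using Finset.induction_on_max_value r with
  | empty =>
    have : IsEmpty ((∅ : Finset ι) : Set ι) := by simp
    exact algebraicIndependent_empty_type_iff.2 (algebraMap K E).injective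
  | insert a s has hmax ih =>
    rw [Finset.coe_insert]
    refine (AlgebraicIndepOn.insert_iff (by simpa using has)).2 ⟨ih s.finite_toSet, fun hal => ?_⟩
    refine h a (acl_mono (Set.union_subset_union_right _ (Set.image_mono fun k hk => ?_))
      (isAlgebraic_adjoin_iff_mem_acl.1 hal))
    exact lt_of_le_of_ne (hmax k hk) fun e => has (hr e ▸ hk)

theorem card_le_trdeg {K : Subfield E} {S : Set E} {ι : Type*} [Fintype ι] {x : ι → E}
    (hx : AlgebraicIndependent K x) (hmem : ∀ i, x i ∈ Subfield.closure ((K : Set E) ∪ S)) :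
    (Fintype.card ι : Cardinal) ≤ Trdeg K (IntermediateField.adjoin K S) := by
  let y : ι → IntermediateField.adjoin K S :=
    fun i => ⟨x i, mem_adjoin_iff_mem_closure.2 (hmem i)⟩
  have hy : AlgebraicIndependent K y :=
    AlgebraicIndependent.of_comp (IntermediateField.adjoin K S).val hx
  have := hy.lift_cardinalMk_le_trdeg
  rw [Cardinal.mk_fintype, Cardinal.lift_natCast, Cardinal.nat_le_lift_iff] at this
  exact this

theorem trdeg_le_card {K : Subfield E} {S : Set E} {ι : Type*} [Fintype ι] {b : ι → E}
    (hS : S ⊆ acl ((K : Set E) ∪ Set.range b)) :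
    Trdeg K (IntermediateField.adjoin K S) ≤ (Fintype.card ι : Cardinal) := by
  classical
  refine ciSup_le' fun s => ?_
  let s' : Set E := (IntermediateField.adjoin K S).val '' s.1
  have hs' : (AlgebraicIndependent.matroid K E).Indep s' := by
    have h1 : AlgebraicIndependent K fun a : s.1 => (IntermediateField.adjoin K S).val a :=
      s.2.map' (f := (IntermediateField.adjoin K S).val) Subtype.val_injective
    exact h1.image
  have hsub : s' ⊆ (AlgebraicIndependent.matroid K E).closure (Set.range b) := by
    rintro _ ⟨a, -, rfl⟩
    rw [AlgebraicIndependent.matroid_closure_eq]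
    refine (Subalgebra.mem_algebraicClosure _ _).2 (isAlgebraic_adjoin_iff_mem_acl.2 ?_)
    have h2 := mem_adjoin_iff_mem_closure.1 a.2
    refine (Subfield.closure_le.2 ?_ : Subfield.closure ((K : Set E) ∪ S) ≤ _) h2
    exact Set.union_subset (Set.subset_union_left.trans (subset_acl _)) hS
  have h3 := hs'.encard_le_eRk_of_subset hsub
  rw [Matroid.eRk_closure_eq] at h3
  have h4 : s.1.encard ≤ (Fintype.card ι : ℕ∞) := by
    rw [← (Subtype.val_injective.injOn :
      Set.InjOn (IntermediateField.adjoin K S).val s.1).encard_image]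
    refine h3.trans ((Matroid.eRk_le_encard _ _).trans ?_)
    rw [← Set.image_univ]
    refine (Set.encard_image_le _ _).trans ?_
    simp
  rw [← Cardinal.toENat_le_natCast]
  exact h4

end AlgebraicClosureOperator

section Derivation

variable {E : Type*} [Field E]

theorem Derivation.mem_acl_of_mem_closure (D : Derivation ℤ E E) {S T : Set E} (hS : S ⊆ acl T)
    (hD : ∀ s ∈ S, D s ∈ acl T) {a : E} (ha : a ∈ Subfield.closure S) : D a ∈ acl T := by
  have key : a ∈ acl T ∧ D a ∈ acl T := by
    induction ha using Subfield.closure_induction with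
    | mem x hx => exact ⟨hS hx, hD x hx⟩
    | one => simp
    | add x y _ _ hx hy => exact ⟨add_mem hx.1 hy.1, by simpa using add_mem hx.2 hy.2⟩
    | neg x _ hx => exact ⟨neg_mem hx.1, by simpa using hx.2⟩
    | inv x _ hx =>
      refine ⟨inv_mem hx.1, ?_⟩
      rw [Derivation.leibniz_inv, smul_eq_mul]
      exact mul_mem (neg_mem (pow_mem (inv_mem hx.1) 2)) hx.2
    | mul x y _ _ hx hy =>
      refine ⟨mul_mem hx.1 hy.1, ?_⟩
      rw [Derivation.leibniz, smul_eq_mul, smul_eq_mul]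
      exact add_mem (mul_mem hx.1 hy.2) (mul_mem hy.1 hx.2)
  exact key.2

theorem Derivation.aeval_sub_mem_acl (D : Derivation ℤ E E) {S T : Set E} (hS : S ⊆ acl T)
    (hD : ∀ s ∈ S, D s ∈ acl T) {a : E} (ha : a ∈ acl T)
    (q : Polynomial (Subfield.closure S)) :
    D (Polynomial.aeval a q) - Polynomial.aeval a (Polynomial.derivative q) * D a ∈ acl T := by
  induction q using Polynomial.induction_on' with
  | add p q hp hq =>
    convert! add_mem hp hq using 1
    simp only [map_add]
    ring
  | monomial n c =>
    have hc : D (c : E) ∈ acl T := D.mem_acl_of_mem_closure hS hD c.2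
    rw [Polynomial.derivative_monomial, Polynomial.aeval_monomial, Polynomial.aeval_monomial,
      Derivation.leibniz, Derivation.leibniz_pow]
    have e : algebraMap (Subfield.closure S) E c = (c : E) := rfl
    convert! mul_mem (pow_mem ha n) hc using 1
    simp [e]
    ring

/-- In characteristic zero, derivatives of elements algebraic over `S` are algebraic over any set
over which `S` and its derivatives are algebraic. -/
theorem Derivation.apply_mem_acl [CharZero E] (D : Derivation ℤ E E) {S T : Set E} (hS : S ⊆ acl T)
    (hD : ∀ s ∈ S, D s ∈ acl T) {a : E} (ha : a ∈ acl S) : D a ∈ acl T := by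
  have haT : a ∈ acl T := acl_le_of_subset hS ha
  have hint : IsIntegral (Subfield.closure S) a := (mem_acl.1 ha).isIntegral
  have h := D.aeval_sub_mem_acl hS hD haT (minpoly (Subfield.closure S) a)
  have hsep := (minpoly.irreducible hint).separable
  have hne := hsep.aeval_derivative_ne_zero (minpoly.aeval _ a)
  rw [minpoly.aeval, map_zero, zero_sub] at h
  have hmem : Polynomial.aeval a (Polynomial.derivative (minpoly (Subfield.closure S) a))
      ∈ acl T := by
    rw [Polynomial.aeval_eq_sum_range]
    refine sum_mem fun i _ => ?_
    rw [Algebra.smul_def]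
    exact mul_mem ((Subfield.closure_le.2 hS : Subfield.closure S ≤ acl T) (SetLike.coe_mem _))
      (pow_mem haT i)
  have := mul_mem (inv_mem hmem) (neg_mem h)
  rwa [neg_neg, inv_mul_cancel_left₀ hne] at this

end Derivation

section Jets

/-- The family of iterated derivatives of the family `ξ`, indexed by the position and the order of
derivation. -/
def jet {E : Type*} (δ : E → E) {ι : Type*} (ξ : ι → E) (p : ι × ℕ) : E := δ^[p.2] (ξ p.1)

theorem setOf_order_le_eq_image_jet {E : Type*} (δ : E → E) {ι : Type*} (ξ : ι → E) (t : ℕ) :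
    {x : E | ∃ i, ∃ j ≤ t, δ^[j] (ξ i) = x} = jet δ ξ '' {p | p.2 ≤ t} := by
  ext x
  simp [jet]

theorem setOf_eq_range_jet {E : Type*} (δ : E → E) {ι : Type*} (ξ : ι → E) :
    {x : E | ∃ i, ∃ k : ℕ, δ^[k] (ξ i) = x} = Set.range (jet δ ξ) := by
  ext x
  simp [jet]

variable {E : Type*} [Field E]

theorem derivation_jet (D : Derivation ℤ E E) {ι : Type*} (ξ : ι → E) (i : ι) (k : ℕ) :
    D (jet D ξ (i, k)) = jet D ξ (i, k + 1) :=
  (Function.iterate_succ_apply' D k (ξ i)).symm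

theorem diffAdjoin_image (δ : E → E) (F : Subfield E) {ι : Type*} (ξ : ι → E) (U : Set ι) :
    diffAdjoin δ F (ξ '' U) = Subfield.closure ((F : Set E) ∪ jet δ ξ '' {p | p.1 ∈ U}) := by
  unfold diffAdjoin
  congr 2
  ext x
  simp [jet]

theorem mem_acl_jet_succ [CharZero E] (D : Derivation ℤ E E) {F : Subfield E}
    (hF : ∀ x ∈ F, D x ∈ F) {ι : Type*} {ξ : ι → E} {s s' : Set (ι × ℕ)}
    (hs : ∀ p ∈ s, jet D ξ p ∈ acl ((F : Set E) ∪ jet D ξ '' s'))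
    (hs' : ∀ p ∈ s, jet D ξ (p.1, p.2 + 1) ∈ acl ((F : Set E) ∪ jet D ξ '' s'))
    {a : E} (ha : a ∈ acl ((F : Set E) ∪ jet D ξ '' s)) :
    D a ∈ acl ((F : Set E) ∪ jet D ξ '' s') := by
  refine D.apply_mem_acl ?_ ?_ ha
  · rintro x (hx | ⟨p, hp, rfl⟩)
    · exact subset_acl _ (Or.inl hx)
    · exact hs p hp
  · rintro x (hx | ⟨p, hp, rfl⟩)
    · exact subset_acl _ (Or.inl (hF x hx))
    · rw [derivation_jet]
      exact hs' p hp

theorem exists_bound_mem_acl {F : Subfield E} {ι : Type*} (x : ι × ℕ → E) {s : Set (ι × ℕ)} {a : E}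
    (ha : a ∈ acl ((F : Set E) ∪ x '' s)) :
    ∃ t : ℕ, a ∈ acl ((F : Set E) ∪ x '' {p | p ∈ s ∧ p.2 ≤ t}) := by
  have h1 : a ∈ (AlgebraicIndependent.matroid F E).closure (x '' s) := by
    rw [AlgebraicIndependent.matroid_closure_eq]
    exact (Subalgebra.mem_algebraicClosure _ _).2 (isAlgebraic_adjoin_iff_mem_acl.2 ha)
  obtain ⟨I, hI, hfin, -, haI⟩ := Matroid.exists_mem_finite_closure_of_mem_closure h1
  have hev : ∀ᶠ t in Filter.atTop, ∀ e ∈ I, e ∈ x '' {p | p ∈ s ∧ p.2 ≤ t} := by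
    refine (Filter.eventually_all_finite hfin).2 fun e he => ?_
    obtain ⟨p, hp, rfl⟩ := hI he
    filter_upwards [Filter.eventually_ge_atTop p.2] with t ht
    exact ⟨p, ⟨hp, ht⟩, rfl⟩
  obtain ⟨t, ht⟩ := hev.exists
  refine ⟨t, isAlgebraic_adjoin_iff_mem_acl.1 ?_⟩
  rw [← Subalgebra.mem_algebraicClosure, ← SetLike.mem_coe,
    ← AlgebraicIndependent.matroid_closure_eq]
  exact Matroid.closure_subset_closure _ ht haI

theorem exists_bound_mem_closure {F : Subfield E} {ι : Type*} (x : ι × ℕ → E) {a : E}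
    (ha : a ∈ Subfield.closure ((F : Set E) ∪ Set.range x)) :
    ∃ t : ℕ, ∀ t', t ≤ t' → a ∈ Subfield.closure ((F : Set E) ∪ x '' {p | p.2 ≤ t'}) := by
  induction ha using Subfield.closure_induction with
  | mem y hy =>
    rcases hy with hy | ⟨p, rfl⟩
    · exact ⟨0, fun _ _ => Subfield.subset_closure (Or.inl hy)⟩
    · exact ⟨p.2, fun _ h => Subfield.subset_closure (Or.inr ⟨p, h, rfl⟩)⟩
  | one => exact ⟨0, fun _ _ => one_mem _⟩
  | add y z _ _ hy hz =>
    obtain ⟨t₁, h₁⟩ := hy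
    obtain ⟨t₂, h₂⟩ := hz
    exact ⟨max t₁ t₂, fun t h => add_mem (h₁ t (by omega)) (h₂ t (by omega))⟩
  | neg y _ hy =>
    obtain ⟨t₁, h₁⟩ := hy
    exact ⟨t₁, fun t h => neg_mem (h₁ t h)⟩
  | inv y _ hy =>
    obtain ⟨t₁, h₁⟩ := hy
    exact ⟨t₁, fun t h => inv_mem (h₁ t h)⟩
  | mul y z _ _ hy hz =>
    obtain ⟨t₁, h₁⟩ := hy
    obtain ⟨t₂, h₂⟩ := hz
    exact ⟨max t₁ t₂, fun t h => mul_mem (h₁ t (by omega)) (h₂ t (by omega))⟩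

end Jets

section Order

variable {E : Type*} [Field E] {δ : E → E} {F : Subfield E} {n d h : ℕ} {ξ : Fin n → E}

theorem HasDimOrder.exists_trdeg_eq (hdim : HasDimOrder δ F ξ d h) : ∃ T : ℕ, ∀ t, T ≤ t →
    Trdeg F (IntermediateField.adjoin F (jet δ ξ '' {p | p.2 ≤ t}))
      = ((d * (t + 1) + h : ℕ) : Cardinal) := by
  obtain ⟨T, hT⟩ := hdim
  refine ⟨T, fun t ht => ?_⟩
  rw [← setOf_order_le_eq_image_jet]
  exact hT t ht

/-- The members of a differentially independent subfamily are at most as many as the differential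
dimension. -/
theorem HasDimOrder.card_le_of_diffIndep (hdim : HasDimOrder δ F ξ d h) {W : Set (Fin n)}
    (hW : DiffIndep δ F fun i : W => ξ i) : W.ncard ≤ d := by
  classical
  obtain ⟨T, hT⟩ := hdim.exists_trdeg_eq
  have key : ∀ t, T ≤ t → W.ncard * (t + 1) ≤ d * (t + 1) + h := by
    intro t ht
    have h1 : AlgebraicIndependent F fun p : W × Fin (t + 1) => jet δ ξ (p.1, p.2) :=
      hW.comp (fun p : W × Fin (t + 1) => ((p.1, p.2) : W × ℕ)) fun p q hpq => by
        simpa [Prod.ext_iff, Fin.ext_iff] using hpq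
    have h2 := card_le_trdeg (S := jet δ ξ '' {p | p.2 ≤ t}) h1 fun p =>
      Subfield.subset_closure (Or.inr ⟨_, Nat.lt_succ_iff.1 p.2.2, rfl⟩)
    rw [hT t ht, Nat.cast_le, Fintype.card_prod, Fintype.card_fin, ← Nat.card_eq_fintype_card,
      Nat.card_coe_set_eq] at h2
    exact h2
  by_contra! hlt
  have h1 := key (max T h) (le_max_left _ _)
  have h2 : h ≤ max T h := le_max_right _ _
  nlinarith [Nat.mul_le_mul_right (max T h + 1) (Nat.succ_le_of_lt hlt)]

theorem exists_mem_acl_of_not_diffIndep {U : Set (Fin n)} {j : Fin n} (hj : j ∉ U)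
    (hU : DiffIndep δ F fun i : U => ξ i)
    (hdep : ¬ DiffIndep δ F fun i : ↥(insert j U) => ξ (i : Fin n)) :
    ∃ m, jet δ ξ (j, m) ∈
      acl ((F : Set E) ∪ jet δ ξ '' {p | p.1 ∈ U ∨ p.1 = j ∧ p.2 < m}) := by
  classical
  by_contra! hcon
  apply hdep
  refine algebraicIndependent_of_forall_lt
    (r := fun p : ↥(insert j U) × ℕ => toLex ((if (p.1 : Fin n) = j then 1 else 0 : ℕ),
      toLex (p.2, (p.1 : Fin n)))) ?_ ?_
  · rintro ⟨p, k⟩ ⟨q, l⟩ hpq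
    simp only [EmbeddingLike.apply_eq_iff_eq, Prod.mk.injEq] at hpq
    exact Prod.ext (Subtype.ext hpq.2.2) hpq.2.1
  · rintro ⟨⟨i, hi⟩, k⟩ hmem
    by_cases hij : i = j
    · subst hij
      refine hcon k (acl_mono (Set.union_subset_union_right _ ?_) hmem)
      rintro _ ⟨⟨⟨q, hq⟩, l⟩, hlt, rfl⟩
      refine ⟨(q, l), ?_, rfl⟩
      rcases hq with rfl | hq
      · right
        simpa [Prod.Lex.toLex_lt_toLex] using hlt
      · exact Or.inl hq
    · have hiU : i ∈ U := hi.resolve_left hij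
      refine hU.notMem_acl (i := (⟨i, hiU⟩, k)) (s := {(⟨i, hiU⟩, k)}ᶜ) (by simp)
        (acl_mono (Set.union_subset_union_right _ ?_) hmem)
      rintro _ ⟨⟨⟨q, hq⟩, l⟩, hlt, rfl⟩
      have hqj : q ≠ j := by
        rintro rfl
        simp [Prod.Lex.toLex_lt_toLex, hij] at hlt
      refine ⟨(⟨q, hq.resolve_left hqj⟩, l), ?_, rfl⟩
      intro heq
      simp only [Set.mem_singleton_iff, Prod.mk.injEq, Subtype.mk.injEq] at heq
      obtain ⟨rfl, rfl⟩ := heq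
      simp at hlt

theorem IsParametric.exists_bound [CharZero E] {D : Derivation ℤ E E} (hF : ∀ x ∈ F, D x ∈ F)
    {U : Set (Fin n)} (hU : IsParametric D F ξ U) :
    ∃ C, ∀ j k, jet D ξ (j, k) ∈
      acl ((F : Set E) ∪ jet D ξ '' {p | p.1 ∈ U ∧ p.2 ≤ C + k ∨ p.2 < C}) := by
  have key : ∀ j, ∃ c, ∀ k, jet D ξ (j, k) ∈
      acl ((F : Set E) ∪ jet D ξ '' {p | p.1 ∈ U ∧ p.2 ≤ c + k ∨ p.2 < c}) := by
    intro j
    by_cases hj : j ∈ U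
    · exact ⟨0, fun k => subset_acl _ (Or.inr ⟨(j, k), Or.inl ⟨hj, by simp⟩, rfl⟩)⟩
    obtain ⟨m, hm⟩ := exists_mem_acl_of_not_diffIndep hj hU.1 (hU.2 j hj)
    obtain ⟨s, hs⟩ := exists_bound_mem_acl _ hm
    have hstep : ∀ k, jet D ξ (j, m + k) ∈
        acl ((F : Set E) ∪ jet D ξ '' {p | p.1 ∈ U ∧ p.2 ≤ s + k ∨ p.1 = j ∧ p.2 < m}) := by
      intro k
      induction k with
      | zero =>
        refine acl_mono (Set.union_subset_union_right _ (Set.image_mono ?_)) hs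
        rintro p ⟨hp | hp, hps⟩
        · exact Or.inl ⟨hp, hps⟩
        · exact Or.inr hp
      | succ k ih =>
        rw [← add_assoc m k 1, ← derivation_jet]
        refine mem_acl_jet_succ D hF (fun p hp => subset_acl _ (Or.inr ⟨p, ?_, rfl⟩)) ?_ ih
        · rcases hp with hp | hp
          · exact Or.inl ⟨hp.1, by omega⟩
          · exact Or.inr hp
        · rintro ⟨i, l⟩ (hp | hp)
          · exact subset_acl _ (Or.inr ⟨(i, l + 1), Or.inl ⟨hp.1, by simp at hp ⊢; omega⟩, rfl⟩)
          · obtain ⟨rfl, hl⟩ := hp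
            obtain hlt | hge := Nat.lt_or_ge (l + 1) m
            · exact subset_acl _ (Or.inr ⟨(i, l + 1), Or.inr ⟨rfl, hlt⟩, rfl⟩)
            · have hlm : l + 1 = m := le_antisymm (Nat.succ_le_of_lt hl) hge
              simp only [hlm]
              refine acl_mono (Set.union_subset_union_right _ (Set.image_mono ?_)) hs
              rintro p ⟨hp | hp, hps⟩
              · exact Or.inl ⟨hp, by omega⟩
              · exact Or.inr hp
    refine ⟨max m s, fun k => ?_⟩
    obtain hk | hk := Nat.lt_or_ge k m
    · exact subset_acl _ (Or.inr ⟨(j, k), Or.inr (by simp [hk]), rfl⟩)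
    · obtain ⟨k, rfl⟩ := Nat.exists_eq_add_of_le hk
      refine acl_mono (Set.union_subset_union_right _ (Set.image_mono ?_)) (hstep k)
      rintro p (hp | hp)
      · exact Or.inl ⟨hp.1, by omega⟩
      · exact Or.inr (by omega)
  choose c hc using key
  refine ⟨Finset.univ.sup c, fun j k => ?_⟩
  have hle : c j ≤ Finset.univ.sup c := Finset.le_sup (Finset.mem_univ j)
  refine acl_mono (Set.union_subset_union_right _ (Set.image_mono ?_)) (hc j k)
  rintro p (hp | hp)
  · exact Or.inl ⟨hp.1, by omega⟩
  · exact Or.inr (by omega)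

/-- A parametric set has at least as many elements as the differential dimension. -/
theorem IsParametric.le_ncard [CharZero E] {D : Derivation ℤ E E} (hF : ∀ x ∈ F, D x ∈ F)
    {U : Set (Fin n)} (hU : IsParametric D F ξ U) (hdim : HasDimOrder D F ξ d h) :
    d ≤ U.ncard := by
  classical
  obtain ⟨T, hT⟩ := hdim.exists_trdeg_eq
  obtain ⟨C, hC⟩ := hU.exists_bound hF
  have key : ∀ t, T ≤ t → d * (t + 1) + h ≤ U.ncard * (C + t + 1) + n * C := by
    intro t ht
    let b : (U × Fin (C + t + 1)) ⊕ (Fin n × Fin C) → E :=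
      Sum.elim (fun p => jet D ξ (p.1, p.2)) (fun p => jet D ξ (p.1, p.2))
    have h2 := trdeg_le_card (K := F) (S := jet D ξ '' {p | p.2 ≤ t}) (b := b) (by
      rintro _ ⟨⟨j, k⟩, hk, rfl⟩
      refine acl_mono (Set.union_subset_union_right _ ?_) (hC j k)
      rintro _ ⟨⟨i, l⟩, hp, rfl⟩
      simp only [Set.mem_ofPred_eq] at hk hp
      rcases hp with ⟨hi, hl⟩ | hl
      · exact ⟨Sum.inl (⟨i, hi⟩, ⟨l, by omega⟩), rfl⟩
      · exact ⟨Sum.inr (i, ⟨l, hl⟩), rfl⟩)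
    rw [hT t ht, Nat.cast_le, Fintype.card_sum, Fintype.card_prod, Fintype.card_fin,
      Fintype.card_prod, Fintype.card_fin, Fintype.card_fin, ← Nat.card_eq_fintype_card,
      Nat.card_coe_set_eq] at h2
    exact h2
  by_contra! hlt
  have h1 := key (T + U.ncard * C + n * C) (by omega)
  set t := T + U.ncard * C + n * C with ht
  nlinarith [Nat.mul_le_mul_right (t + 1) (Nat.succ_le_of_lt hlt)]

theorem IsParametric.relOrder_le [CharZero E] {D : Derivation ℤ E E} (hF : ∀ x ∈ F, D x ∈ F)
    {U : Set (Fin n)} (hU : IsParametric D F ξ U) (hdim : HasDimOrder D F ξ d h) :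
    relOrder D F ξ U ≤ h := by
  classical
  obtain ⟨T, hT⟩ := hdim.exists_trdeg_eq
  have hd := hU.le_ncard hF hdim
  refine ciSup_le' fun s => ?_
  by_contra! hlt
  obtain ⟨f⟩ : Nonempty (Fin (h + 1) ↪ s.1) := by
    rw [← Cardinal.lift_mk_le', Cardinal.mk_fin, Cardinal.lift_natCast, Cardinal.nat_le_lift_iff,
      Nat.cast_succ]
    exact Cardinal.add_one_le_of_lt hlt
  set K := diffAdjoin D F (ξ '' U) with hK
  rw [diffAdjoin_image] at hK
  have hFK : F ≤ K := fun x hx => hK ▸ Subfield.subset_closure (Or.inl hx)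
  let y : Fin (h + 1) → E := fun i => ((f i : s.1).1 : E)
  have hy : AlgebraicIndependent K y :=
    (AlgebraicIndependent.map' (s.2.comp f f.injective)
      (f := IntermediateField.val _) Subtype.val_injective)
  have hmem : ∀ i, y i ∈ Subfield.closure ((F : Set E) ∪ Set.range (jet D ξ)) := by
    intro i
    have h1 := mem_adjoin_iff_mem_closure.1 (f i : s.1).1.2
    refine (Subfield.closure_le.2 ?_ : _ ≤ Subfield.closure _) h1
    refine Set.union_subset ?_ ?_
    · rw [diffAdjoin_image]
      exact Subfield.closure_mono (Set.union_subset_union_right _ (Set.image_subset_range _ _))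
    · rw [setOf_eq_range_jet]
      exact Set.subset_union_right.trans Subfield.subset_closure
  choose t₀ ht₀ using fun i => exists_bound_mem_closure _ (hmem i)
  set t := max T (Finset.univ.sup t₀)
  let u : U × Fin (t + 1) → E := fun p => jet D ξ (p.1, p.2)
  have hu : AlgebraicIndependent F u :=
    hU.1.comp (fun p : U × Fin (t + 1) => ((p.1, p.2) : U × ℕ)) fun p q hpq => by
      simpa [Prod.ext_iff, Fin.ext_iff] using hpq
  let _ : Algebra F K := (Subfield.inclusion hFK).toAlgebra
  have : IsScalarTower F K E := IsScalarTower.of_algebraMap_eq fun _ => rfl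
  have huK : Set.range u ⊆ Set.range (algebraMap K E) := by
    rintro _ ⟨p, rfl⟩
    have h1 : u p ∈ K := hK ▸ Subfield.subset_closure (Or.inr ⟨_, p.1.2, rfl⟩)
    exact ⟨⟨u p, h1⟩, rfl⟩
  have h1 := card_le_trdeg (S := jet D ξ '' {p | p.2 ≤ t}) (hu.sumElim_of_tower huK hy) (by
    rintro (i | p)
    · exact ht₀ i t ((Finset.le_sup (Finset.mem_univ i)).trans (le_max_right _ _))
    · exact Subfield.subset_closure (Or.inr ⟨_, Nat.lt_succ_iff.1 p.2.2, rfl⟩))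
  rw [hT t (le_max_left _ _), Nat.cast_le, Fintype.card_sum, Fintype.card_prod, Fintype.card_fin,
    Fintype.card_fin, ← Nat.card_eq_fintype_card, Nat.card_coe_set_eq] at h1
  have := Nat.mul_le_mul_right (t + 1) hd
  omega

end Order

section NonLeaders

variable {E : Type*} [Field E] {F : Subfield E} {n d h : ℕ} {ξ : Fin n → E}

/-- The orderly ranking of derivatives: first by order, then by position. -/
def orderlyRank {n : ℕ} (p : Fin n × ℕ) : ℕ ×ₗ Fin n := toLex (p.2, p.1)

theorem orderlyRank_injective {n : ℕ} : Function.Injective (orderlyRank (n := n)) := by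
  rintro ⟨i, k⟩ ⟨j, l⟩ h
  simp only [orderlyRank, EmbeddingLike.apply_eq_iff_eq, Prod.mk.injEq] at h
  exact Prod.ext h.2 h.1

theorem orderlyRank_lt {n : ℕ} {p q : Fin n × ℕ} :
    orderlyRank p < orderlyRank q ↔ p.2 < q.2 ∨ p.2 = q.2 ∧ p.1 < q.1 :=
  Prod.Lex.toLex_lt_toLex

/-- The derivatives of `ξ` that are not algebraic over the derivatives of lower orderly rank. -/
def nonLeaders (δ : E → E) (F : Subfield E) (ξ : Fin n → E) : Set (Fin n × ℕ) :=
  {p | jet δ ξ p ∉ acl ((F : Set E) ∪ jet δ ξ '' {q | orderlyRank q < orderlyRank p})}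

theorem algebraicIndependent_nonLeaders (δ : E → E) (F : Subfield E) (ξ : Fin n → E) :
    AlgebraicIndependent F fun p : nonLeaders δ F ξ => jet δ ξ p := by
  refine algebraicIndependent_of_forall_lt (fun p => orderlyRank (p : Fin n × ℕ))
    (orderlyRank_injective.comp Subtype.val_injective) fun p hp => p.2 ?_
  refine acl_mono (Set.union_subset_union_right _ ?_) hp
  rintro _ ⟨q, hq, rfl⟩
  exact ⟨q, hq, rfl⟩

theorem jet_mem_acl_nonLeaders (δ : E → E) (F : Subfield E) (ξ : Fin n → E) (p : Fin n × ℕ) :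
    jet δ ξ p ∈ acl ((F : Set E) ∪ jet δ ξ '' {q | q ∈ nonLeaders δ F ξ ∧ q.2 ≤ p.2}) := by
  induction hr : orderlyRank p using WellFoundedLT.induction generalizing p with
  | ind r ih =>
    subst hr
    by_cases hp : p ∈ nonLeaders δ F ξ
    · exact subset_acl _ (Or.inr ⟨p, ⟨hp, le_rfl⟩, rfl⟩)
    · refine acl_le_of_subset ?_ (not_not.1 hp)
      rintro _ (hx | ⟨q, hq, rfl⟩)
      · exact subset_acl _ (Or.inl hx)
      · refine acl_mono (Set.union_subset_union_right _ (Set.image_mono ?_)) (ih _ hq q rfl)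
        have := orderlyRank_lt.1 hq
        exact fun a ha => ⟨ha.1, by have := ha.2; omega⟩

theorem succ_notMem_nonLeaders [CharZero E] {D : Derivation ℤ E E} (hF : ∀ x ∈ F, D x ∈ F)
    {i : Fin n} {k : ℕ} (hp : (i, k) ∉ nonLeaders D F ξ) : (i, k + 1) ∉ nonLeaders D F ξ := by
  refine not_not.2 ?_
  rw [← derivation_jet]
  refine mem_acl_jet_succ D hF (fun p hlt => ?_) (fun p hlt => ?_) (not_not.1 hp)
  · refine subset_acl _ (Or.inr ⟨p, ?_, rfl⟩)
    have := orderlyRank_lt.1 hlt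
    exact orderlyRank_lt.2 (Or.inl (by simp at this ⊢; omega))
  · refine subset_acl _ (Or.inr ⟨(p.1, p.2 + 1), ?_, rfl⟩)
    have := orderlyRank_lt.1 hlt
    exact orderlyRank_lt.2 (by simpa using this)

/-- The positions none of whose derivatives is a leader. -/
def leaderFree (δ : E → E) (F : Subfield E) (ξ : Fin n → E) : Set (Fin n) :=
  {i | ∀ k, (i, k) ∈ nonLeaders δ F ξ}

/-- The nonleaders at positions carrying a leader. -/
def residualNonLeaders (δ : E → E) (F : Subfield E) (ξ : Fin n → E) : Set (Fin n × ℕ) :=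
  {p | p ∈ nonLeaders δ F ξ ∧ p.1 ∉ leaderFree δ F ξ}

theorem exists_residualNonLeaders_bound [CharZero E] {D : Derivation ℤ E E}
    (hF : ∀ x ∈ F, D x ∈ F) (ξ : Fin n → E) : ∃ M, ∀ p ∈ residualNonLeaders D F ξ, p.2 < M := by
  have key : ∀ i, ∃ m, i ∉ leaderFree D F ξ → ∀ k, m ≤ k → (i, k) ∉ nonLeaders D F ξ := by
    intro i
    by_cases hi : i ∈ leaderFree D F ξ
    · exact ⟨0, fun h => absurd hi h⟩
    · obtain ⟨m, hm⟩ := not_forall.1 hi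
      refine ⟨m, fun _ k hk => ?_⟩
      induction k, hk using Nat.le_induction with
      | base => exact hm
      | succ k _ ih => exact succ_notMem_nonLeaders hF ih
  choose m hm using key
  refine ⟨Finset.univ.sup m, fun p hp => ?_⟩
  by_contra! hle
  exact hm p.1 hp.2 p.2 ((Finset.le_sup (Finset.mem_univ p.1)).trans hle) hp.1

theorem finite_residualNonLeaders [CharZero E] {D : Derivation ℤ E E}
    (hF : ∀ x ∈ F, D x ∈ F) (ξ : Fin n → E) : (residualNonLeaders D F ξ).Finite := by
  obtain ⟨M, hM⟩ := exists_residualNonLeaders_bound hF ξ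
  exact (Set.finite_univ.prod (Set.finite_Iio M)).subset fun p hp => ⟨trivial, hM p hp⟩

theorem HasDimOrder.ncard_leaderFree [CharZero E] {D : Derivation ℤ E E}
    (hF : ∀ x ∈ F, D x ∈ F) (hdim : HasDimOrder D F ξ d h) :
    (leaderFree D F ξ).ncard = d ∧ (residualNonLeaders D F ξ).ncard = h := by
  classical
  obtain ⟨T, hT⟩ := hdim.exists_trdeg_eq
  obtain ⟨M, hM⟩ := exists_residualNonLeaders_bound hF ξ
  have := (finite_residualNonLeaders hF ξ).fintype
  set U := leaderFree D F ξ
  set R := residualNonLeaders D F ξ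
  have key : ∀ t, max T M ≤ t → d * (t + 1) + h = U.ncard * (t + 1) + R.ncard := by
    intro t ht
    let e : (U × Fin (t + 1)) ⊕ R → nonLeaders D F ξ :=
      Sum.elim (fun p => ⟨(p.1, p.2), p.1.2 p.2⟩) (fun p => ⟨p, p.2.1⟩)
    have he : Function.Injective e := by
      refine Function.Injective.sumElim ?_ ?_ ?_
      · intro p q hpq
        simp only [Subtype.mk.injEq, Prod.mk.injEq] at hpq
        exact Prod.ext (Subtype.ext hpq.1) (Fin.ext hpq.2)
      · intro p q hpq
        simpa [Subtype.ext_iff] using hpq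
      · intro p q hpq
        simp only [Subtype.mk.injEq] at hpq
        exact q.2.2 (hpq ▸ p.1.2)
    have hle : ∀ a, (e a : Fin n × ℕ).2 ≤ t := by
      rintro (p | p)
      · exact Nat.lt_succ_iff.1 p.2.2
      · exact (hM p p.2).le.trans ((le_max_right _ _).trans ht)
    have h1 := card_le_trdeg (S := jet D ξ '' {p | p.2 ≤ t})
      ((algebraicIndependent_nonLeaders D F ξ).comp e he) fun a =>
        Subfield.subset_closure (Or.inr ⟨_, hle a, rfl⟩)
    have h2 := trdeg_le_card (K := F) (S := jet D ξ '' {p | p.2 ≤ t})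
      (b := fun a => jet D ξ (e a)) (by
        rintro _ ⟨p, hp, rfl⟩
        refine acl_mono (Set.union_subset_union_right _ ?_) (jet_mem_acl_nonLeaders D F ξ p)
        rintro _ ⟨⟨i, k⟩, ⟨hq, hqp⟩, rfl⟩
        by_cases hi : i ∈ U
        · exact ⟨Sum.inl (⟨i, hi⟩, ⟨k, Nat.lt_succ_iff.2 (hqp.trans hp)⟩), rfl⟩
        · exact ⟨Sum.inr ⟨(i, k), hq, hi⟩, rfl⟩)
    have h3 := le_antisymm h1 h2
    rw [hT t ((le_max_left _ _).trans ht), Nat.cast_inj, Fintype.card_sum, Fintype.card_prod,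
      Fintype.card_fin, ← Nat.card_eq_fintype_card, ← Nat.card_eq_fintype_card,
      Nat.card_coe_set_eq, Nat.card_coe_set_eq] at h3
    exact h3.symm
  have h1 := key _ le_rfl
  have h2 := key _ (Nat.le_succ _)
  have hd : U.ncard = d := by
    simp only [Nat.succ_eq_add_one, mul_add, mul_one] at h1 h2
    omega
  refine ⟨hd, ?_⟩
  rw [hd] at h1
  omega

theorem diffIndep_leaderFree (δ : E → E) (F : Subfield E) (ξ : Fin n → E) :
    DiffIndep δ F fun i : leaderFree δ F ξ => ξ i :=
  (algebraicIndependent_nonLeaders δ F ξ).comp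
    (fun p : leaderFree δ F ξ × ℕ => ⟨(p.1, p.2), p.1.2 p.2⟩) fun p q hpq => by
      simpa [Prod.ext_iff, Subtype.ext_iff] using hpq

theorem HasDimOrder.isParametric_leaderFree [CharZero E] {D : Derivation ℤ E E}
    (hF : ∀ x ∈ F, D x ∈ F) (hdim : HasDimOrder D F ξ d h) :
    IsParametric D F ξ (leaderFree D F ξ) := by
  refine ⟨diffIndep_leaderFree D F ξ, fun j hj hind => ?_⟩
  have h1 := hdim.card_le_of_diffIndep hind
  rw [Set.ncard_insert_of_notMem hj, (hdim.ncard_leaderFree hF).1] at h1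
  omega

theorem HasDimOrder.relOrder_leaderFree [CharZero E] {D : Derivation ℤ E E}
    (hF : ∀ x ∈ F, D x ∈ F) (hdim : HasDimOrder D F ξ d h) :
    relOrder D F ξ (leaderFree D F ξ) = h := by
  classical
  have := (finite_residualNonLeaders hF ξ).fintype
  have hcard : Fintype.card (residualNonLeaders D F ξ) = h := by
    rw [← Nat.card_eq_fintype_card, Nat.card_coe_set_eq, (hdim.ncard_leaderFree hF).2]
  have hacl : ∀ S : Set E, acl ((diffAdjoin D F (ξ '' leaderFree D F ξ) : Set E) ∪ S) =
      acl ((F : Set E) ∪ jet D ξ '' {p | p.1 ∈ leaderFree D F ξ} ∪ S) := fun S => by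
    rw [diffAdjoin_image, acl_closure_union]
  have hind : AlgebraicIndependent (diffAdjoin D F (ξ '' leaderFree D F ξ))
      fun p : residualNonLeaders D F ξ => jet D ξ p := by
    refine algebraicIndependent_of_forall_lt (fun p => orderlyRank (p : Fin n × ℕ))
      (orderlyRank_injective.comp Subtype.val_injective) fun p hp => ?_
    rw [hacl, Set.union_assoc] at hp
    refine (algebraicIndependent_nonLeaders D F ξ).notMem_acl (i := ⟨p, p.2.1⟩)
      (s := {⟨p, p.2.1⟩}ᶜ) (by simp) (acl_mono (Set.union_subset_union_right _ ?_) hp)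
    rintro _ (⟨q, hq, rfl⟩ | ⟨q, hq, rfl⟩)
    · refine ⟨⟨q, hq q.2⟩, fun heq => p.2.2 ?_, rfl⟩
      simp only [Set.mem_singleton_iff, Subtype.mk.injEq] at heq
      exact heq ▸ hq
    · refine ⟨⟨q, q.2.1⟩, fun heq => ?_, rfl⟩
      simp only [Set.mem_singleton_iff, Subtype.mk.injEq] at heq
      exact absurd hq (by simp [heq])
  rw [← hcard]
  refine le_antisymm (trdeg_le_card (b := fun p : residualNonLeaders D F ξ => jet D ξ p) ?_)
    (card_le_trdeg hind fun p => Subfield.subset_closure (Or.inr ⟨_, _, rfl⟩))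
  rw [setOf_eq_range_jet]
  rintro _ ⟨p, rfl⟩
  rw [hacl, Set.union_assoc]
  refine acl_mono (Set.union_subset_union_right _ ?_) (jet_mem_acl_nonLeaders D F ξ p)
  rintro _ ⟨q, hq, rfl⟩
  by_cases hi : q.1 ∈ leaderFree D F ξ
  · exact Or.inl ⟨q, hi, rfl⟩
  · exact Or.inr ⟨⟨q, hq.1, hi⟩, rfl⟩

end NonLeaders

/-- **The order is the maximum of the relative orders.**  If `ξ` has differential
dimension `d` and order `h` over `F`, then every parametric subset has (finite) relative
order at most `h`, and some parametric subset has relative order exactly `h`. -/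
theorem order_eq_max_relative_order
    {E : Type*} [Field E] [CharZero E] (δ : E → E)
    (hδadd : ∀ a b : E, δ (a + b) = δ a + δ b)
    (hδmul : ∀ a b : E, δ (a * b) = a * δ b + δ a * b)
    (F : Subfield E) (hF : ∀ x ∈ F, δ x ∈ F)
    (n d h : ℕ) (ξ : Fin n → E)
    (hdim : HasDimOrder δ F ξ d h) :
    (∀ U : Set (Fin n), IsParametric δ F ξ U → relOrder δ F ξ U ≤ (h : Cardinal)) ∧
    (∃ U : Set (Fin n), IsParametric δ F ξ U ∧ relOrder δ F ξ U = (h : Cardinal)) := by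
  obtain ⟨D, rfl⟩ : ∃ D : Derivation ℤ E E, ⇑D = δ :=
    ⟨Derivation.mk' (AddMonoidHom.mk' δ hδadd).toIntLinearMap fun a b => by
      simp [hδmul, mul_comm], rfl⟩
  exact ⟨fun U hU => hU.relOrder_le hF hdim,
    _, hdim.isParametric_leaderFree hF, hdim.relOrder_leaderFree hF⟩
end

section
/- Let F be an ordinary differential field of characteristic zero and E a differential field extension of F. Let ξ = (ξ_1,…,ξ_n) ∈ E^n, and fix natural numbers s ≥ 0 and m ≥ 1. Let M be the set of all exponent vectors α = (α_{jk})_{1≤j≤n, 0≤k≤s} of nonnegative integers with 1 ≤ |α| ≤ m, where |α| = Σ_{j,k} α_{jk}, and for α ∈ M write ξ^α = Π_{j=1}^n Π_{k=0}^s (δ^k ξ_j)^{α_{jk}}. Let (u_α)_{α∈M} be a family of elements of E that is differentially independent over F⟨ξ_1,…,ξ_n⟩, and set ζ_0 = −Σ_{α∈M} u_α ξ^α (the value at ξ of the nonconstant part of a generic differential polynomial of order s and degree m with coefficients u_α). Then ζ_0 is differentially transcendental over the differential subfield F⟨u_α : α ∈ M⟩ if and only if at least one ξ_i is differentially transcendental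 over F. -/
set_option synthInstance.maxHeartbeats 1000000
set_option maxHeartbeats 1000000

/-- The set of exponent vectors `α = (α_{jk})_{1≤j≤n, 0≤k≤s}` of nonnegative integers
with `1 ≤ |α| ≤ m` (each entry is then automatically at most `m`, so entries are coded
in `Fin (m+1)`). -/
abbrev GenMon (n s m : ℕ) : Type :=
  {α : Fin n × Fin (s + 1) → Fin (m + 1) //
    1 ≤ ∑ p : Fin n × Fin (s + 1), ((α p : ℕ)) ∧ ∑ p : Fin n × Fin (s + 1), ((α p : ℕ)) ≤ m}

/-- The monomial value `ξ^α = ∏_{j,k} (δᵏ ξⱼ)^{α_{jk}}`. -/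
noncomputable def monValue {E : Type*} [Field E] (δ : E → E) {n : ℕ} (s m : ℕ)
    (ξ : Fin n → E) (α : GenMon n s m) : E :=
  ∏ p : Fin n × Fin (s + 1), (δ^[(p.2 : ℕ)] (ξ p.1)) ^ ((α.1 p : ℕ))


section RelativeAlgebraicClosure

variable {E : Type*} [Field E]

/-- The relative algebraic closure in `E` of the subfield generated by `S`. -/
def relAlgClosure (S : Set E) : Subfield E :=
  (algebraicClosure (Subfield.closure S) E).toSubfield

theorem mem_relAlgClosure {S : Set E} {x : E} :
    x ∈ relAlgClosure S ↔ IsAlgebraic (Subfield.closure S) x :=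
  mem_algebraicClosure_iff

theorem closure_le_relAlgClosure (S : Set E) : Subfield.closure S ≤ relAlgClosure S := fun x hx =>
  mem_relAlgClosure.2 (isAlgebraic_algebraMap (⟨x, hx⟩ : Subfield.closure S))

theorem subset_relAlgClosure (S : Set E) : S ⊆ relAlgClosure S := fun _ hx =>
  closure_le_relAlgClosure S (Subfield.subset_closure hx)

theorem IsAlgebraic.of_subfield_le_s5 {A B : Subfield E} (h : A ≤ B) {x : E}
    (hx : IsAlgebraic A x) : IsAlgebraic B x := by
  let _ : Algebra A B := (Subfield.inclusion h).toAlgebra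
  have : IsScalarTower A B E := .of_algebraMap_eq fun _ => rfl
  exact hx.tower_top B

theorem relAlgClosure_le {S T : Set E} (h : S ⊆ relAlgClosure T) :
    relAlgClosure S ≤ relAlgClosure T := by
  intro x hx
  have hx' : IsAlgebraic (relAlgClosure T) x :=
    (mem_relAlgClosure.1 hx).of_subfield_le_s5 (Subfield.closure_le.2 h)
  have hx'' : IsAlgebraic (algebraicClosure (Subfield.closure T) E) x := hx'
  exact mem_relAlgClosure.2 (hx''.restrictScalars _)

theorem relAlgClosure_mono {S T : Set E} (h : S ⊆ T) : relAlgClosure S ≤ relAlgClosure T :=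
  relAlgClosure_le (h.trans (subset_relAlgClosure T))

theorem toSubfield_adjoin_eq (K : Subfield E) (S : Set E) :
    (IntermediateField.adjoin K S).toSubfield = Subfield.closure (K ∪ S) := by
  rw [IntermediateField.adjoin_toSubfield]
  congr 2
  ext x
  exact ⟨by rintro ⟨y, rfl⟩; exact y.2, fun hx => ⟨⟨x, hx⟩, rfl⟩⟩

theorem mem_relAlgClosure_union {K : Subfield E} {S : Set E} {x : E} :
    x ∈ relAlgClosure (K ∪ S) ↔ IsAlgebraic (Algebra.adjoin K S) x := by
  rw [mem_relAlgClosure, ← IntermediateField.isAlgebraic_adjoin_iff, ← toSubfield_adjoin_eq]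
  rfl

theorem algebraicIndependent_closure_union_iff {K : Subfield E} {S : Set E} {ι : Type*}
    {x : ι → E} : AlgebraicIndependent (Subfield.closure (K ∪ S)) x ↔
      AlgebraicIndependent (Algebra.adjoin K S) x := by
  rw [← IntermediateField.algebraicIndependent_adjoin_iff, ← toSubfield_adjoin_eq]
  rfl

/-- A relative algebraic closure of a finitely generated extension of `K` contains no infinite
algebraically independent family. -/
theorem not_algebraicIndependent_of_mem_relAlgClosure {K : Subfield E} {T : Set E}
    (hT : T.Finite) {ι : Type*} [Infinite ι] {z : ι → E}
    (hz : ∀ k, z k ∈ relAlgClosure (K ∪ T)) : ¬ AlgebraicIndependent K z := by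
  intro h
  have hind : (AlgebraicIndependent.matroid K E).Indep (Set.range z) :=
    AlgebraicIndependent.matroid_indep_iff.2 h.to_subtype_range
  have hsub : Set.range z ⊆ (AlgebraicIndependent.matroid K E).closure T := by
    rintro _ ⟨k, rfl⟩
    rw [AlgebraicIndependent.matroid_closure_eq]
    exact mem_relAlgClosure_union.1 (hz k)
  have hle := hind.encard_le_eRk_of_subset hsub
  rw [Matroid.eRk_closure_eq] at hle
  have hfin : (Set.range z).encard < ⊤ :=
    (hle.trans (Matroid.eRk_le_encard _ _)).trans_lt (Set.encard_lt_top_iff.2 hT)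
  exact Set.infinite_range_of_injective h.injective (Set.encard_lt_top_iff.1 hfin)

/-- A sequence which is not algebraically independent has a term that is algebraic over the
preceding ones. -/
theorem exists_mem_relAlgClosure_of_not_algebraicIndependent {K : Subfield E} {z : ℕ → E}
    (h : ¬ AlgebraicIndependent K z) :
    ∃ N, z N ∈ relAlgClosure (K ∪ z '' Set.Iio N) := by
  by_contra! hN
  have hfin : ∀ N, AlgebraicIndepOn K z (Set.Iio N) := by
    intro N
    induction N with
    | zero =>
      rw [show Set.Iio 0 = (∅ : Set ℕ) by ext; simp]
      exact algebraicIndependent_empty_type_iff.2 (algebraMap K E).injective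
    | succ N ih =>
      rw [show Set.Iio (N + 1) = insert N (Set.Iio N) by
        ext; simp [le_iff_eq_or_lt]]
      exact ih.insert fun halg => hN N (mem_relAlgClosure_union.2 halg)
  refine h (algebraicIndependent_of_finite_type fun t ht => ?_)
  obtain ⟨N, hN⟩ := ht.bddAbove
  exact (hfin (N + 1)).mono fun k hk => Nat.lt_succ_of_le (hN hk)

end RelativeAlgebraicClosure

section AffineTransform

open Polynomial

/-- If `a * x + r` is algebraic over `k(x)`, where `x` is transcendental over a field `R`
containing `k`, `a` and `r`, then `a` is algebraic over `k`. -/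
theorem isAlgebraic_of_affine_isAlgebraic {E : Type*} [Field E] {k R : Subfield E} (hkR : k ≤ R)
    {x a r : E} (ha : a ∈ R) (hr : r ∈ R) (hx : Transcendental R x)
    (h : IsAlgebraic (Algebra.adjoin k {x}) (a * x + r)) : IsAlgebraic k a := by
  have hxk : Transcendental k x := fun h => hx (h.of_subfield_le_s5 hkR)
  obtain ⟨q, hq0, hq⟩ : ∃ q : k[X][X], q ≠ 0 ∧
      q.eval₂ (aeval x : k[X] →ₐ[k] E).toRingHom (a * x + r) = 0 := by
    obtain ⟨p, hp0, hp⟩ := h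
    let f : k[X] →ₐ[k] Algebra.adjoin k {x} := (aeval x : k[X] →ₐ[k] E).codRestrict _ fun q =>
      Algebra.adjoin_singleton_eq_range_aeval k x ▸ ⟨q, rfl⟩
    have hf : Function.Surjective f := by
      rintro ⟨b, hb⟩
      obtain ⟨q, rfl⟩ := Algebra.adjoin_singleton_eq_range_aeval k x ▸ hb
      exact ⟨q, rfl⟩
    obtain ⟨q, rfl⟩ := map_surjective f.toRingHom hf p
    refine ⟨q, fun h0 => hp0 (by simp [h0]), ?_⟩
    rw [aeval_def, eval₂_map] at hp
    exact hp
  let i : k →+* R := Subfield.inclusion hkR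
  let y : R[X] := C ⟨a, ha⟩ * X + C ⟨r, hr⟩
  have hy : y.natDegree ≤ 1 := natDegree_linear_le
  have hzero : q.sum (fun j c => c.map i * y ^ j) = 0 := by
    refine transcendental_iff.1 hx _ ?_
    rw [Polynomial.sum, map_sum, ← hq, eval₂_eq_sum, Polynomial.sum]
    refine Finset.sum_congr rfl fun j _ => ?_
    simp only [map_mul, map_pow, y, map_add, aeval_X, aeval_C]
    congr 1
    rw [aeval_def, eval₂_map]
    rfl
  let d := q.support.sup fun j => (q.coeff j).natDegree + j
  obtain ⟨j₀, hj₀, hd⟩ := q.support.exists_mem_eq_sup (support_nonempty.2 hq0)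
    fun j => (q.coeff j).natDegree + j
  have hle : ∀ j ∈ q.support, (q.coeff j).natDegree + j ≤ d := fun j hj =>
    Finset.le_sup (f := fun j => (q.coeff j).natDegree + j) hj
  refine ⟨∑ j ∈ q.support, C ((q.coeff j).coeff (d - j)) * X ^ j, fun h0 => ?_, ?_⟩
  · have := congrArg (fun p => p.coeff j₀) h0
    simp only [finsetSum_coeff, coeff_C_mul_X_pow, coeff_zero] at this
    rw [Finset.sum_ite_eq] at this
    rw [if_pos hj₀, show d - j₀ = (q.coeff j₀).natDegree by simp only [d]; omega] at this
    exact mem_support_iff.1 hj₀ (leadingCoeff_eq_zero.1 this)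
  · have hcoeff : ∀ j ∈ q.support, ((q.coeff j).map i * y ^ j).coeff d =
        i ((q.coeff j).coeff (d - j)) * ⟨a, ha⟩ ^ j := by
      intro j hj
      have hj' := hle j hj
      have hyj : (y ^ j).natDegree ≤ j := by simpa using natDegree_pow_le_of_le j hy
      have hy1 : (y ^ j).coeff j = ⟨a, ha⟩ ^ j := by
        have := coeff_pow_of_natDegree_le (m := j) hy
        simpa [y] using this
      have hde : d = d - j + j := by omega
      rw [← hy1, ← coeff_map]
      conv_lhs => rw [hde]
      exact coeff_mul_add_eq_of_natDegree_le
        (natDegree_map_le.trans (by omega)) hyj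
    have := congrArg (fun p => ((p.coeff d : R) : E)) hzero
    simp only [Polynomial.sum, finsetSum_coeff, Finset.sum_congr rfl hcoeff] at this
    have hcast : ∀ c : k, algebraMap k E c = (i c : E) := fun _ => rfl
    simpa [hcast] using this

end AffineTransform

section DifferentialClosure

open Polynomial

variable {E : Type*} [Field E]

theorem Derivation.apply_mem_of_mem_closure (D : Derivation ℤ E E) {S : Set E} {C : Subfield E}
    (hS : S ⊆ C) (hD : ∀ g ∈ S, D g ∈ C) {x : E} (hx : x ∈ Subfield.closure S) : D x ∈ C := by
  have hle : Subfield.closure S ≤ C := Subfield.closure_le.2 hS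
  induction hx using Subfield.closure_induction with
  | mem x hx => exact hD x hx
  | one => simp
  | add x y _ _ hx hy => rw [map_add]; exact add_mem hx hy
  | neg x _ hx => rw [map_neg]; exact neg_mem hx
  | inv x hx' hx =>
    rw [D.leibniz_inv, smul_eq_mul]
    exact mul_mem (neg_mem (pow_mem (inv_mem (hle hx')) 2)) hx
  | mul x y hx' hy' hx hy =>
    rw [D.leibniz, smul_eq_mul, smul_eq_mul]
    exact add_mem (mul_mem (hle hx') hy) (mul_mem (hle hy') hx)

variable [CharZero E]

theorem Derivation.apply_mem_relAlgClosure (D : Derivation ℤ E E) {S : Set E}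
    (hD : ∀ g ∈ S, D g ∈ relAlgClosure S) {x : E} (hx : x ∈ relAlgClosure S) :
    D x ∈ relAlgClosure S := by
  set A := Subfield.closure S
  have hA : ∀ c : A, (c : E) ∈ relAlgClosure S := fun c => closure_le_relAlgClosure S c.2
  have hDA : ∀ c : A, D c ∈ relAlgClosure S := fun c =>
    D.apply_mem_of_mem_closure (subset_relAlgClosure S) hD c.2
  have key : ∀ p : A[X], D (aeval x p) - aeval x (derivative p) * D x ∈ relAlgClosure S := by
    intro p
    induction p using Polynomial.induction_on' with
    | add p q hp hq =>
      have := add_mem hp hq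
      simp only [map_add, add_mul]
      convert this using 1
      ring
    | monomial n c =>
      have hmem := mul_mem (pow_mem hx n) (hDA c)
      convert hmem using 1
      have hc : algebraMap A E c = c := rfl
      have hn : algebraMap A E (n : A) = n := _root_.map_natCast (algebraMap A E) n
      simp only [aeval_monomial, derivative_monomial, D.leibniz, D.leibniz_pow, smul_eq_mul,
        map_mul, hc, hn, nsmul_eq_mul]
      ring
  have halg : IsAlgebraic A x := mem_relAlgClosure.1 hx
  have hint : IsIntegral A x := halg.isIntegral
  have hne : aeval x (derivative (minpoly A x)) ≠ 0 :=
    (minpoly.irreducible hint).separable.aeval_derivative_ne_zero (minpoly.aeval A x)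
  have hder : ∀ p : A[X], aeval x p ∈ relAlgClosure S := fun p => by
    rw [aeval_eq_sum_range]
    exact sum_mem fun j _ => by
      rw [Algebra.smul_def]
      exact mul_mem (hA _) (pow_mem hx j)
  have h := key (minpoly A x)
  rw [minpoly.aeval, map_zero, zero_sub, neg_mem_iff] at h
  have := mul_mem (inv_mem (hder (derivative (minpoly A x)))) h
  rwa [inv_mul_cancel_left₀ hne] at this

/-- Adjoining finitely many derivatives of each `y i` to a differential field `K` and closing
algebraically yields a differential field if each `y i` has its next derivative in there. -/
theorem Derivation.iterate_mem_relAlgClosure (D : Derivation ℤ E E) {K : Subfield E}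
    (hK : ∀ x ∈ K, D x ∈ K) {ι : Type*} {y : ι → E} {N : ι → ℕ}
    (hN : ∀ i, D^[N i] (y i) ∈
      relAlgClosure (K ∪ ⋃ i, (fun k => D^[k] (y i)) '' Set.Iio (N i)))
    {z : E} (hz : z ∈ relAlgClosure (K ∪ ⋃ i, (fun k => D^[k] (y i)) '' Set.Iio (N i)))
    (k : ℕ) : D^[k] z ∈ relAlgClosure (K ∪ ⋃ i, (fun k => D^[k] (y i)) '' Set.Iio (N i)) := by
  induction k with
  | zero => exact hz
  | succ k ih =>
    rw [Function.iterate_succ_apply']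
    refine D.apply_mem_relAlgClosure ?_ ih
    rintro g (hg | hg)
    · exact subset_relAlgClosure _ (Or.inl (hK g hg))
    · obtain ⟨i, k, hk, rfl⟩ := Set.mem_iUnion.1 hg
      dsimp only
      rw [← Function.iterate_succ_apply' D k]
      rcases (Nat.succ_le_of_lt hk).lt_or_eq with hlt | heq
      · exact subset_relAlgClosure _ (Or.inr (Set.mem_iUnion.2 ⟨i, k + 1, hlt, rfl⟩))
      · rw [show k.succ = N i from heq]
        exact hN i

theorem Derivation.not_algebraicIndependent_iterate (D : Derivation ℤ E E) {K : Subfield E}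
    (hK : ∀ x ∈ K, D x ∈ K) {ι : Type*} [Finite ι] {y : ι → E} {N : ι → ℕ}
    (hN : ∀ i, D^[N i] (y i) ∈
      relAlgClosure (K ∪ ⋃ i, (fun k => D^[k] (y i)) '' Set.Iio (N i)))
    {z : E} (hz : z ∈ relAlgClosure (K ∪ ⋃ i, (fun k => D^[k] (y i)) '' Set.Iio (N i))) :
    ¬ AlgebraicIndependent K fun k => D^[k] z :=
  not_algebraicIndependent_of_mem_relAlgClosure
    (Set.finite_iUnion fun _ => (Set.finite_Iio _).image _) (D.iterate_mem_relAlgClosure hK hN hz)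

end DifferentialClosure

section GenericValue

variable {E : Type*} [Field E]

theorem subset_diffAdjoin (δ : E → E) (F : Subfield E) (S : Set E) : F ≤ diffAdjoin δ F S :=
  fun _ hx => Subfield.subset_closure (Or.inl hx)

theorem iterate_mem_diffAdjoin (δ : E → E) (F : Subfield E) {S : Set E} {x : E} (hx : x ∈ S)
    (k : ℕ) : δ^[k] x ∈ diffAdjoin δ F S :=
  Subfield.subset_closure (Or.inr ⟨x, hx, k, rfl⟩)

theorem diffAdjoin_range (δ : E → E) (F : Subfield E) {ι : Type*} (a : ι → E) :
    diffAdjoin δ F (Set.range a) =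
      Subfield.closure (F ∪ Set.range fun p : ι × ℕ => δ^[p.2] (a p.1)) := by
  rw [diffAdjoin]
  congr 2
  ext x
  simp

theorem Derivation.apply_mem_diffAdjoin (D : Derivation ℤ E E) {F : Subfield E}
    (hF : ∀ x ∈ F, D x ∈ F) (S : Set E) {x : E} (hx : x ∈ diffAdjoin D F S) :
    D x ∈ diffAdjoin D F S := by
  refine D.apply_mem_of_mem_closure Subfield.subset_closure ?_ hx
  rintro g (hg | ⟨s, hs, k, rfl⟩)
  · exact subset_diffAdjoin D F S (hF g hg)
  · rw [← Function.iterate_succ_apply' D k]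
    exact iterate_mem_diffAdjoin D F hs _

/-- Modulo the derivatives of the `u α` of order `< N`, the `N`-th derivative of `∑ α, u α * c α`
is `∑ α, δ^N (u α) * c α`. -/
theorem Derivation.iterate_sum_mul_sub_mem (D : Derivation ℤ E E) {L : Subfield E}
    (hL : ∀ x ∈ L, D x ∈ L) {ι : Type*} [Fintype ι] (u c : ι → E) (hc : ∀ α, c α ∈ L) (N : ℕ) :
    D^[N] (∑ α, u α * c α) - ∑ α, D^[N] (u α) * c α ∈
      Subfield.closure (L ∪ {x | ∃ α, ∃ k < N, D^[k] (u α) = x}) := by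
  induction N with
  | zero => simp
  | succ N ih =>
    set T : ℕ → Set E := fun N => {x | ∃ α, ∃ k < N, D^[k] (u α) = x}
    have hsub : (L ∪ T N : Set E) ⊆ Subfield.closure (L ∪ T (N + 1) : Set E) := by
      rintro x (hx | ⟨α, k, hk, rfl⟩)
      · exact Subfield.subset_closure (Or.inl hx)
      · exact Subfield.subset_closure (Or.inr ⟨α, k, by omega, rfl⟩)
    have hD := D.apply_mem_of_mem_closure hsub (by
      rintro x (hx | ⟨α, k, hk, rfl⟩)
      · exact Subfield.subset_closure (Or.inl (hL x hx))
      · rw [← Function.iterate_succ_apply' D k]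
        exact Subfield.subset_closure (Or.inr ⟨α, k + 1, by omega, rfl⟩)) ih
    have hlow : ∑ α, D^[N] (u α) * D (c α) ∈ Subfield.closure (L ∪ T (N + 1) : Set E) :=
      sum_mem fun α _ => mul_mem (Subfield.subset_closure (Or.inr ⟨α, N, by omega, rfl⟩))
        (Subfield.subset_closure (Or.inl (hL _ (hc α))))
    convert add_mem hD hlow using 1
    rw [map_sub, map_sum, ← Function.iterate_succ_apply' D N, sub_add, ← Finset.sum_sub_distrib]
    congr 1
    refine Finset.sum_congr rfl fun α _ => ?_
    rw [D.leibniz, smul_eq_mul, smul_eq_mul, ← Function.iterate_succ_apply' D N]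
    ring

/-- A differentially transcendental element of a subfield `L` stays differentially transcendental
after adjoining elements that are differentially independent over `L`. -/
theorem DiffIndep.algebraicIndependent_diffAdjoin {δ : E → E} {F L : Subfield E} (hFL : F ≤ L)
    {ι : Type*} {u : ι → E} (hu : DiffIndep δ L u) {κ : Type*} {x : κ → E} (hxL : ∀ k, x k ∈ L)
    (hx : AlgebraicIndependent F x) :
    AlgebraicIndependent (diffAdjoin δ F (Set.range u)) x := by
  let _ : Algebra F L := (Subfield.inclusion hFL).toAlgebra
  have : IsScalarTower F L E := .of_algebraMap_eq fun _ => rfl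
  have hsum := hx.sumElim_of_tower (by rintro _ ⟨k, rfl⟩; exact ⟨⟨x k, hxL k⟩, rfl⟩) hu
  have hswap : AlgebraicIndependent F
      (Sum.elim x fun p : ι × ℕ => δ^[p.2] (u p.1)) := by
    convert hsum.comp _ (Equiv.sumComm _ _).injective using 1
    ext (_ | _) <;> rfl
  rw [diffAdjoin_range, algebraicIndependent_closure_union_iff]
  exact (AlgebraicIndependent.sumElim_iff.1 hswap).2

theorem DiffIndep.transcendental_closure {δ : E → E} {L : Subfield E} {ι : Type*} {u : ι → E}
    (hu : DiffIndep δ L u) (q : ι × ℕ) :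
    Transcendental
      (Subfield.closure (L ∪ (fun p : ι × ℕ => δ^[p.2] (u p.1)) '' {q}ᶜ)) (δ^[q.2] (u q.1)) := by
  rw [Transcendental, ← mem_relAlgClosure, mem_relAlgClosure_union]
  exact AlgebraicIndependent.transcendental_adjoin hu (i := q) (by simp)

variable [CharZero E]

theorem Derivation.exists_not_algebraicIndependent_of_sum (D : Derivation ℤ E E) {F L : Subfield E}
    (hL : ∀ x ∈ L, D x ∈ L) (hF : ∀ x ∈ F, D x ∈ F) (hFL : F ≤ L) {ι : Type*} [Fintype ι]
    {u c : ι → E} (hu : DiffIndep D L u) (hc : ∀ α, c α ∈ L) {ζ : E}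
    (hζ : ζ = -∑ α, u α * c α)
    (h : ¬ AlgebraicIndependent (diffAdjoin D F (Set.range u)) fun k : ℕ => D^[k] ζ) (e : ι) :
    ¬ AlgebraicIndependent F fun k : ℕ => D^[k] (c e) := by
  classical
  set K := diffAdjoin D F (Set.range u) with hKdef
  have hK : ∀ x ∈ K, D x ∈ K := fun x hx => D.apply_mem_diffAdjoin hF _ hx
  obtain ⟨N, hN⟩ := exists_mem_relAlgClosure_of_not_algebraicIndependent h
  set v : ι × ℕ → E := fun p => D^[p.2] (u p.1) with hv
  set Z : Set E := (fun k => D^[k] ζ) '' Set.Iio N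
  set R := Subfield.closure (L ∪ v '' {(e, N)}ᶜ)
  have hLR : ∀ x ∈ L, x ∈ R := fun x hx => Subfield.subset_closure (Or.inl hx)
  have huR : ∀ p, p ≠ (e, N) → v p ∈ R := fun p hp => Subfield.subset_closure (Or.inr ⟨p, hp, rfl⟩)
  have hdiff : ∀ k ≤ N, D^[k] ζ + ∑ α, D^[k] (u α) * c α ∈ R := by
    intro k hk
    have hsub : Subfield.closure (L ∪ {x | ∃ α, ∃ j < k, D^[j] (u α) = x}) ≤ R := by
      refine Subfield.closure_le.2 ?_
      rintro x (hx | ⟨α, j, hj, rfl⟩)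
      · exact hLR x hx
      · exact huR (α, j) fun h => by have := congrArg Prod.snd h; dsimp only at this; omega
    have := neg_mem (hsub (D.iterate_sum_mul_sub_mem hL u c hc k))
    rwa [neg_sub, sub_eq_neg_add, ← iterate_map_neg, ← hζ] at this
  have hZR : Z ⊆ R := by
    rintro _ ⟨k, hk, rfl⟩
    have hk : k < N := hk
    have hsum : ∑ α, D^[k] (u α) * c α ∈ R := sum_mem fun α _ =>
      mul_mem (huR (α, k) fun h => hk.ne (congrArg Prod.snd h)) (hLR _ (hc α))
    have := sub_mem (hdiff k hk.le) hsum
    rwa [add_sub_cancel_right] at this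
  set k₀ := Subfield.closure (F ∪ (v '' {(e, N)}ᶜ ∪ Z))
  have hk₀R : k₀ ≤ R := by
    refine Subfield.closure_le.2 ?_
    rintro x (hx | ⟨p, hp, rfl⟩ | hx)
    · exact hLR x (hFL hx)
    · exact huR p hp
    · exact hZR hx
  have hk₀K : k₀ ≤ relAlgClosure (K ∪ Z) := by
    refine Subfield.closure_le.2 ?_
    rintro x (hx | ⟨p, -, rfl⟩ | hx)
    · exact subset_relAlgClosure _ (Or.inl (subset_diffAdjoin D F _ hx))
    · exact subset_relAlgClosure _ (Or.inl (iterate_mem_diffAdjoin D F (Set.mem_range_self p.1) p.2))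
    · exact subset_relAlgClosure _ (Or.inr hx)
  set x := v (e, N)
  obtain ⟨r, hr, hζN⟩ : ∃ r ∈ R, D^[N] ζ = -c e * x + r := by
    have hrest : ∑ α ∈ Finset.univ.erase e, D^[N] (u α) * c α ∈ R := sum_mem fun α hα =>
      mul_mem (huR (α, N) fun h => Finset.ne_of_mem_erase hα (congrArg Prod.fst h)) (hLR _ (hc α))
    refine ⟨_, sub_mem (hdiff N le_rfl) hrest, ?_⟩
    rw [← Finset.add_sum_erase _ _ (Finset.mem_univ e)]
    simp only [x, hv]
    ring
  have hKx : (K ∪ Z : Set E) ⊆ relAlgClosure (k₀ ∪ {x}) := by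
    have hle : Subfield.closure (k₀ ∪ {x} : Set E) ≤ _ := closure_le_relAlgClosure _
    rintro y (hy | hy)
    · rw [hKdef, diffAdjoin_range] at hy
      refine hle (Subfield.closure_le.2 ?_ hy)
      rintro y (hy | ⟨p, rfl⟩)
      · exact Subfield.subset_closure (Or.inl (Subfield.subset_closure (Or.inl hy)))
      · by_cases hp : p = (e, N)
        · exact Subfield.subset_closure (Or.inr (by rw [hp]; rfl))
        · exact Subfield.subset_closure (Or.inl (Subfield.subset_closure
            (Or.inr (Or.inl ⟨p, hp, rfl⟩))))
    · exact hle (Subfield.subset_closure (Or.inl (Subfield.subset_closure (Or.inr (Or.inr hy)))))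
  have halg := mem_relAlgClosure_union.1 (relAlgClosure_le hKx hN)
  rw [hζN] at halg
  have hce : IsAlgebraic k₀ (-c e) := isAlgebraic_of_affine_isAlgebraic hk₀R
    (neg_mem (hLR _ (hc e))) hr (hu.transcendental_closure (e, N)) halg
  have hmem : c e ∈ relAlgClosure (K ∪ Z) :=
    relAlgClosure_le (fun y hy => hk₀K (Subfield.subset_closure hy))
      (mem_relAlgClosure.2 (by simpa using hce.neg))
  intro hind
  have hZ : (⋃ _ : Unit, (fun k => D^[k] ζ) '' Set.Iio N) = Z := Set.iUnion_const _
  refine D.not_algebraicIndependent_iterate hK (ι := Unit) (y := fun _ => ζ) (N := fun _ => N)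
    (fun _ => by rwa [hZ]) (z := c e) (by rwa [hZ]) ?_
  refine hu.algebraicIndependent_diffAdjoin hFL (fun k => ?_) hind
  induction k with
  | zero => exact hc e
  | succ k ih => rw [Function.iterate_succ_apply']; exact hL _ ih

end GenericValue
/-- **Differential transcendence of the value of a generic differential polynomial.**
Let `(u_α)_{α∈M}` be differentially independent over `F⟨ξ₁,…,ξₙ⟩` and
`ζ₀ = −∑_{α∈M} u_α ξ^α` (the value at `ξ` of the nonconstant part of a generic
differential polynomial of order `s` and degree `m`).  Then `ζ₀` is differentially
transcendental over `F⟨u_α : α ∈ M⟩` if and only if some `ξᵢ` is differentially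
transcendental over `F`. -/
theorem generic_value_diff_transcendental_iff
    {E : Type*} [Field E] [CharZero E] (δ : E → E)
    (hδadd : ∀ a b : E, δ (a + b) = δ a + δ b)
    (hδmul : ∀ a b : E, δ (a * b) = a * δ b + δ a * b)
    (F : Subfield E) (hF : ∀ x ∈ F, δ x ∈ F)
    (n s m : ℕ) (hm : 1 ≤ m) (ξ : Fin n → E)
    (u : GenMon n s m → E)
    (hu : DiffIndep δ (diffAdjoin δ F (Set.range ξ)) u)
    (ζ0 : E) (hζ0 : ζ0 = -∑ α : GenMon n s m, u α * monValue δ s m ξ α) :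
    AlgebraicIndependent (diffAdjoin δ F (Set.range u)) (fun k : ℕ => δ^[k] ζ0) ↔
      ∃ i : Fin n, AlgebraicIndependent F (fun k : ℕ => δ^[k] (ξ i)) := by
  obtain ⟨D, rfl⟩ : ∃ D : Derivation ℤ E E, ⇑D = δ :=
    ⟨Derivation.mk' (AddMonoidHom.mk' δ hδadd).toIntLinearMap fun a b => by
      simp [hδmul, mul_comm], rfl⟩
  set K := diffAdjoin D F (Set.range u)
  constructor
  · intro h
    by_contra! hξ
    choose N hN using fun i => exists_mem_relAlgClosure_of_not_algebraicIndependent (hξ i)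
    have hFK : F ≤ K := subset_diffAdjoin D F _
    have hKD : ∀ x ∈ K, D x ∈ K := fun x hx => D.apply_mem_diffAdjoin hF _ hx
    set C := relAlgClosure (K ∪ ⋃ i, (fun k => D^[k] (ξ i)) '' Set.Iio (N i))
    have hNC : ∀ i, D^[N i] (ξ i) ∈ C := fun i =>
      relAlgClosure_mono (Set.union_subset_union hFK
        (Set.subset_iUnion (fun i => (fun k => D^[k] (ξ i)) '' Set.Iio (N i)) i)) (hN i)
    have hξC : ∀ i, ξ i ∈ C := by
      intro i
      rcases Nat.eq_zero_or_pos (N i) with h0 | hpos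
      · simpa [h0] using hNC i
      · exact subset_relAlgClosure _ (Or.inr (Set.mem_iUnion.2 ⟨i, 0, hpos, rfl⟩))
    refine D.not_algebraicIndependent_iterate hKD hNC (z := ζ0) ?_ h
    rw [hζ0]
    refine neg_mem (sum_mem fun α _ => mul_mem ?_ (prod_mem fun p _ => pow_mem ?_ _))
    · exact subset_relAlgClosure _ (Or.inl (iterate_mem_diffAdjoin D F (Set.mem_range_self α) 0))
    · exact D.iterate_mem_relAlgClosure hKD hNC (hξC p.1) _
  · rintro ⟨i, hi⟩
    by_contra h
    classical
    obtain ⟨e, he⟩ : ∃ e : GenMon n s m, monValue D s m ξ e = ξ i := by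
      have hval : ∀ p : Fin n × Fin (s + 1),
          ((Pi.single (i, 0) ⟨1, by omega⟩ : Fin n × Fin (s + 1) → Fin (m + 1)) p : ℕ) =
            if p = (i, 0) then 1 else 0 := by
        intro p
        by_cases hp : p = (i, 0)
        · subst hp; simp
        · simp [hp]
      refine ⟨⟨Pi.single (i, 0) ⟨1, by omega⟩, ?_⟩, ?_⟩
      · simp only [hval]
        simpa using hm
      · simp only [monValue, hval, pow_ite, pow_one, pow_zero]
        simp
    refine D.exists_not_algebraicIndependent_of_sum
      (fun x hx => D.apply_mem_diffAdjoin hF _ hx) hF (subset_diffAdjoin D F _) hu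
      (c := monValue D s m ξ) (fun α => ?_) hζ0 h e (by rwa [he])
    exact prod_mem fun p _ => pow_mem (iterate_mem_diffAdjoin D F (Set.mem_range_self p.1) _) _
end

section
/- Let F be an ordinary differential field of characteristic zero and E a differential field extension of F. Let ξ = (ξ_1,…,ξ_n) ∈ E^n and d ∈ ℕ be such that the differential transcendence degree of F⟨ξ_1,…,ξ_n⟩ over F is d; precisely, there is a subset T ⊆ {1,…,n} with |T| = d such that (ξ_i)_{i∈T} is differentially independent over F, while for every subset S ⊆ {1,…,n} with |S| = d+1 the family (ξ_i)_{i∈S} is differentially dependent over F. Let u_{σρ} (0 ≤ σ ≤ d, 1 ≤ ρ ≤ n) be elements of E that are differentially independent over F⟨ξ_1,…,ξ_n⟩, set ζ_σ = −Σ_{ρ=1}^n u_{σρ} ξ_ρ for 0 ≤ σ ≤ d, and let K = F⟨u_{σρ} : 0 ≤ σ ≤ d, 1 ≤ ρ ≤ n⟩. Then ζ_0, ζ_1, …, ζ_d are differentially dependent over K, and if d > 0 then ζ_1, …, ζ_d are differentially independent over K (so the differential transcendence degree of K⟨ζ_0,…,ζ_d⟩ over K equals d). -/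
set_option synthInstance.maxHeartbeats 1000000
set_option maxHeartbeats 1000000

open MvPolynomial in
theorem AlgebraicIndependent.sumElim_X_of_eval {F L I J : Type*} [Field F] [Field L] [Algebra F L]
    (Z : J → MvPolynomial I L) (c : I → F)
    (h : AlgebraicIndependent F (fun j => eval (fun i => algebraMap F L (c i)) (Z j))) :
    AlgebraicIndependent F (Sum.elim (X : I → MvPolynomial I L) Z) := by
  let κ : MvPolynomial (I ⊕ J) F →ₐ[F] MvPolynomial I L :=
    aeval (Sum.elim X (algebraMap L (MvPolynomial I L) ∘
      fun j => eval (fun i => algebraMap F L (c i)) (Z j)))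
  have hκ : Function.Injective κ :=
    h.sumElim_comp (y := (X : I → MvPolynomial I L)) (algebraicIndependent_X I L)
  let ψ : MvPolynomial (I ⊕ J) F →ₐ[F] Polynomial (MvPolynomial (I ⊕ J) F) :=
    aeval (Sum.elim
      (fun i => Polynomial.C (C (c i)) + Polynomial.X * Polynomial.C (X (Sum.inl i)))
      (fun j => Polynomial.C (X (Sum.inr j))))
  let θ : Polynomial (MvPolynomial (I ⊕ J) F) →+* MvPolynomial (I ⊕ J) F :=
    Polynomial.eval₂RingHom (aeval (Sum.elim (fun i => X (Sum.inl i) - C (c i))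
      (fun j => X (Sum.inr j))) : MvPolynomial (I ⊕ J) F →ₐ[F] _).toRingHom 1
  have hθψ : θ.comp ψ.toRingHom = RingHom.id _ := by
    apply MvPolynomial.ringHom_ext
    · intro a
      simp [θ, ψ, Polynomial.algebraMap_apply, MvPolynomial.algebraMap_eq]
    · rintro (i | j) <;> simp [θ, ψ, MvPolynomial.algebraMap_eq]
  have hψ : Function.Injective ψ := by
    intro a b hab
    have h1 := congrArg θ hab
    have h2 := fun p => congrArg (fun f : _ →+* _ => f p) hθψ
    simp only [AlgHom.toRingHom_eq_coe, RingHom.comp_apply, RingHom.coe_coe, RingHom.id_apply]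
      at h2
    rwa [h2, h2] at h1
  let γ : MvPolynomial I L →ₐ[L] Polynomial (MvPolynomial I L) :=
    aeval (fun i => Polynomial.C (C (algebraMap F L (c i))) + Polynomial.X * Polynomial.C (X i))
  let β : Polynomial (MvPolynomial (I ⊕ J) F) →+* Polynomial (MvPolynomial I L) :=
    Polynomial.eval₂RingHom (aeval (Sum.elim (fun i => Polynomial.C (X i))
      (fun j => γ (Z j))) : MvPolynomial (I ⊕ J) F →ₐ[F] _).toRingHom Polynomial.X
  have hβψ : β.comp ψ.toRingHom =
      γ.toRingHom.comp (aeval (Sum.elim X Z) : MvPolynomial (I ⊕ J) F →ₐ[F] _).toRingHom := by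
    apply MvPolynomial.ringHom_ext
    · intro a
      simp [β, ψ, γ, Polynomial.algebraMap_apply, MvPolynomial.algebraMap_apply]
    · rintro (i | j) <;>
        simp [β, ψ, γ, Polynomial.algebraMap_apply, MvPolynomial.algebraMap_apply]
  have hγ0 : (Polynomial.evalRingHom 0).comp γ.toRingHom =
      C.comp (eval (fun i => algebraMap F L (c i))) := by
    apply MvPolynomial.ringHom_ext
    · intro a
      simp [γ, Polynomial.algebraMap_apply]
    · intro i
      simp [γ]
  have hβ0 : (Polynomial.evalRingHom 0).comp β = κ.toRingHom.comp (Polynomial.evalRingHom 0) := by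
    apply Polynomial.ringHom_ext
    · intro a
      have : ((Polynomial.evalRingHom 0).comp β).comp Polynomial.C =
          (κ.toRingHom.comp (Polynomial.evalRingHom 0)).comp Polynomial.C := by
        apply MvPolynomial.ringHom_ext
        · intro a
          simp [β, κ, Polynomial.algebraMap_apply]
        · rintro (i | j)
          · simp [β, κ]
          · simpa [β, κ] using congrArg (fun f : _ →+* _ => f (Z j)) hγ0
      exact congrArg (fun f : _ →+* _ => f a) this
    · simp [β, κ]
  rw [algebraicIndependent_iff]
  intro p hp
  by_contra hp0
  have hq0 : ψ p ≠ 0 := fun h0 => hp0 (hψ (by rw [h0, map_zero]))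
  obtain ⟨r, hr, hnd⟩ := Polynomial.exists_eq_pow_rootMultiplicity_mul_and_not_dvd (ψ p) hq0 0
  have h1 : β (ψ p) = 0 := by
    have := congrArg (fun f : _ →+* _ => f p) hβψ
    simpa [hp] using this
  rw [hr, map_mul, map_pow] at h1
  have hX : β (Polynomial.X - Polynomial.C 0) = Polynomial.X := by simp [β]
  rw [hX] at h1
  have h2 : β r = 0 := by
    rcases mul_eq_zero.mp h1 with h1 | h1
    · exact absurd h1 (pow_ne_zero _ Polynomial.X_ne_zero)
    · exact h1
  have h3 := congrArg (fun f : _ →+* _ => f r) hβ0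
  simp only [RingHom.comp_apply, h2, map_zero] at h3
  apply hnd
  rw [Polynomial.dvd_iff_isRoot]
  exact hκ (by simpa using h3.symm)

theorem iterate_mul_eq_sum {E : Type*} [CommRing E] (δ : E → E)
    (hδadd : ∀ a b : E, δ (a + b) = δ a + δ b)
    (hδmul : ∀ a b : E, δ (a * b) = a * δ b + δ a * b) (k : ℕ) (a b : E) :
    δ^[k] (a * b) =
      ∑ p ∈ Finset.HasAntidiagonal.antidiagonal k,
        (k.choose p.1 : E) * (δ^[p.1] a * δ^[p.2] b) := by
  let D : E →+ E := AddMonoidHom.mk' δ hδadd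
  have hD : ∀ x, δ x = D x := fun _ => rfl
  induction k with
  | zero => simp
  | succ k ih =>
    rw [Finset.sum_antidiagonal_choose_succ_mul (fun i j => δ^[i] a * δ^[j] b),
      Function.iterate_succ_apply', ih, hD, map_sum, ← Finset.sum_add_distrib]
    refine Finset.sum_congr rfl fun p hp => ?_
    rw [← Nat.choose_symm_of_eq_add (Finset.HasAntidiagonal.mem_antidiagonal.mp hp).symm,
      ← nsmul_eq_mul, map_nsmul, ← hD, hδmul, Function.iterate_succ_apply', Function.iterate_succ_apply',
      nsmul_eq_mul]
    ring

theorem iterate_neg_sum_mul {E ι : Type*} [CommRing E] (δ : E → E)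
    (hδadd : ∀ a b : E, δ (a + b) = δ a + δ b)
    (hδmul : ∀ a b : E, δ (a * b) = a * δ b + δ a * b) (k : ℕ) (s : Finset ι) (a b : ι → E) :
    δ^[k] (-∑ i ∈ s, a i * b i) =
      -∑ i ∈ s, ∑ p ∈ Finset.HasAntidiagonal.antidiagonal k,
        (k.choose p.1 : E) * (δ^[p.1] (a i) * δ^[p.2] (b i)) := by
  let D : AddMonoid.End E := AddMonoidHom.mk' δ hδadd
  have hD : ∀ x, δ^[k] x = (D ^ k) x := fun x => by
    rw [AddMonoid.End.coe_pow]
    rfl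
  rw [hD, map_neg, map_sum]
  congr 1
  refine Finset.sum_congr rfl fun i _ => ?_
  rw [← hD, iterate_mul_eq_sum δ hδadd hδmul]

section

variable {E : Type*} [Field E]

theorem Derivation.mem_of_isAlgebraic [CharZero E] (D : Derivation ℤ E E) {L M : Subfield E}
    (hLM : L ≤ M) (hD : ∀ y ∈ L, D y ∈ M) {x : E} (hxM : x ∈ M) (hx : IsAlgebraic L x) :
    D x ∈ M := by
  have eval_mem : ∀ p : Polynomial L, Polynomial.aeval x p ∈ M := fun p => by
    rw [Polynomial.aeval_eq_sum_range]
    exact sum_mem fun i _ => mul_mem (hLM (p.coeff i).2) (pow_mem hxM i)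
  have key : ∀ p : Polynomial L,
      D (Polynomial.aeval x p) - Polynomial.aeval x (Polynomial.derivative p) * D x ∈ M := by
    intro p
    induction p using Polynomial.induction_on' with
    | add p q hp hq =>
      convert add_mem hp hq using 1
      simp only [map_add]
      ring
    | monomial n a =>
      have h : D (Polynomial.aeval x (Polynomial.monomial n a)) -
          Polynomial.aeval x (Polynomial.derivative (Polynomial.monomial n a)) * D x =
          x ^ n * D (a : E) := by
        have ha : algebraMap L E (a * n) = (a : E) * n := rfl
        have ha' : algebraMap L E a = (a : E) := rfl
        simp only [Polynomial.aeval_monomial, Derivation.leibniz, Derivation.leibniz_pow,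
          Polynomial.derivative_monomial, smul_eq_mul, nsmul_eq_mul, ha, ha']
        ring
      rw [h]
      exact mul_mem (pow_mem hxM n) (hD _ a.2)
  have hsep : (minpoly L x).Separable := (minpoly.irreducible hx.isIntegral).separable
  have hne := hsep.aeval_derivative_ne_zero (minpoly.aeval L x)
  have h := key (minpoly L x)
  rw [minpoly.aeval, map_zero, zero_sub] at h
  have h2 := mul_mem (inv_mem (eval_mem (Polynomial.derivative (minpoly L x)))) (neg_mem h)
  rwa [neg_neg, inv_mul_cancel_left₀ hne] at h2

theorem Derivation.mem_of_mem_subfieldClosure (D : Derivation ℤ E E) {s : Set E}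
    {M : Subfield E} (hs : s ⊆ M) (hD : ∀ y ∈ s, D y ∈ M) {x : E} (hx : x ∈ Subfield.closure s) :
    D x ∈ M := by
  have hM : ∀ y ∈ Subfield.closure s, y ∈ M := fun y hy => Subfield.closure_le.mpr hs hy
  induction hx using Subfield.closure_induction with
  | mem x hx => exact hD x hx
  | one => simp
  | add x y _ _ hx hy => rw [map_add]; exact add_mem hx hy
  | neg x _ hx => rw [map_neg]; exact neg_mem hx
  | inv x hx' hx =>
    rw [Derivation.leibniz_inv]
    exact mul_mem (neg_mem (pow_mem (inv_mem (hM x hx')) 2)) hx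
  | mul x y hx' hy' hx hy =>
    rw [Derivation.leibniz]
    exact add_mem (mul_mem (hM x hx') hy) (mul_mem (hM y hy') hx)

namespace Subfield

open AlgebraicIndependent

variable (F : Subfield E)

theorem mem_matroid_closure_iff {S : Set E} {x : E} :
    x ∈ (matroid F E).closure S ↔ IsAlgebraic (closure ((F : Set E) ∪ S)) x := by
  have h : Set.range (algebraMap F E) = (F : Set E) := Subtype.range_coe
  rw [matroid_closure_eq, SetLike.mem_coe, Subalgebra.mem_algebraicClosure,
    ← IntermediateField.isAlgebraic_adjoin_iff, ← h]
  rfl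

theorem exists_coe_eq_matroid_closure (S : Set E) :
    ∃ M : Subfield E, (M : Set E) = (matroid F E).closure S ∧ F ≤ M := by
  refine ⟨(algebraicClosure (closure ((F : Set E) ∪ S)) E).toSubfield, ?_, fun x hx => ?_⟩
  · ext x
    rw [SetLike.mem_coe, mem_matroid_closure_iff]
    exact mem_algebraicClosure_iff
  · exact algebraMap_mem (algebraicClosure (closure ((F : Set E) ∪ S)) E)
      ⟨x, subset_closure (Or.inl hx)⟩

theorem isAlgebraic_of_le {L M : Subfield E} (h : L ≤ M) {x : E} (hx : IsAlgebraic L x) :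
    IsAlgebraic M x := by
  let _ : Algebra L M := (Subfield.inclusion h).toAlgebra
  have : IsScalarTower L M E := .of_algebraMap_eq fun _ => rfl
  exact hx.tower_top M

theorem matroid_closure_mono {K : Subfield E} (h : F ≤ K) (S : Set E) :
    (matroid F E).closure S ⊆ (matroid K E).closure S := fun x hx => by
  rw [mem_matroid_closure_iff] at hx ⊢
  exact isAlgebraic_of_le (closure_mono (Set.union_subset_union_left _ h)) hx

theorem derivation_mem_matroid_closure [CharZero E] (D : Derivation ℤ E E)
    (hF : ∀ x ∈ F, D x ∈ F) {A B : Set E} (hA : A ⊆ (matroid F E).closure B)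
    (hD : ∀ y ∈ A, D y ∈ (matroid F E).closure B) {x : E} (hx : x ∈ (matroid F E).closure A) :
    D x ∈ (matroid F E).closure B := by
  have hxB := Matroid.closure_subset_closure_of_subset_closure hA hx
  obtain ⟨M, hM, hFM⟩ := exists_coe_eq_matroid_closure F B
  rw [mem_matroid_closure_iff] at hx
  rw [← hM] at hA hxB ⊢
  simp only [← hM] at hD
  have hFA : (F : Set E) ∪ A ⊆ M := Set.union_subset hFM hA
  refine D.mem_of_isAlgebraic (closure_le.mpr hFA) (fun y hy => ?_) hxB hx
  refine D.mem_of_mem_subfieldClosure hFA ?_ hy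
  rintro z (hz | hz)
  · exact hFM (hF z hz)
  · exact hD z hz

theorem encard_le_of_subset_matroid_closure {I Y : Set E}
    (hI : AlgebraicIndepOn F id I) (h : I ⊆ (matroid F E).closure Y) : I.encard ≤ Y.encard :=
  calc I.encard ≤ (matroid F E).eRk ((matroid F E).closure Y) :=
        (matroid_indep_iff.mpr hI).encard_le_eRk_of_subset h
    _ = (matroid F E).eRk Y := Matroid.eRk_closure_eq _ _
    _ ≤ Y.encard := Matroid.eRk_le_encard _ _

end Subfield

theorem diffIndep_subtype_iff (δ : E → E) (K : Subfield E) {ι : Type*} (a : ι → E)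
    (T : Finset ι) : DiffIndep δ K (fun i : T => a i) ↔
      AlgebraicIndepOn K (fun p : ι × ℕ => δ^[p.2] (a p.1)) {p | p.1 ∈ T} := by
  let e : T × ℕ ≃ {p : ι × ℕ | p.1 ∈ T} :=
    { toFun := fun p => ⟨(p.1.1, p.2), p.1.2⟩
      invFun := fun p => (⟨p.1.1, p.2⟩, p.1.2)
      left_inv := fun _ => rfl
      right_inv := fun _ => rfl }
  exact algebraicIndependent_equiv' e rfl

open AlgebraicIndependent in
theorem exists_iterate_mem_matroid_closure (δ : E → E) (F : Subfield E) {ι : Type*}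
    [DecidableEq ι] (a : ι → E) {T : Finset ι} {i : ι} (hi : i ∉ T)
    (hT : DiffIndep δ F (fun j : T => a j))
    (hdep : ¬ DiffIndep δ F (fun j : (insert i T : Finset ι) => a j)) :
    ∃ m e : ℕ, δ^[e] (a i) ∈ (matroid F E).closure
      ((fun p : ι × ℕ => δ^[p.2] (a p.1)) ''
        {p | p.1 ∈ T ∧ p.2 ≤ m ∨ p.1 = i ∧ p.2 < e}) := by
  rw [diffIndep_subtype_iff] at hT hdep
  by_contra! H
  set f : ι × ℕ → E := fun p => δ^[p.2] (a p.1) with hf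
  have step : ∀ m e, AlgebraicIndepOn F f {p | p.1 ∈ T ∧ p.2 ≤ m ∨ p.1 = i ∧ p.2 < e} := by
    intro m e
    induction e with
    | zero =>
      refine AlgebraicIndepOn.mono hT ?_
      rintro p (hp | hp)
      · exact hp.1
      · exact absurd hp.2 (Nat.not_lt_zero _)
    | succ e ih =>
      have h := H m e
      rw [matroid_closure_eq, SetLike.mem_coe, Subalgebra.mem_algebraicClosure] at h
      refine AlgebraicIndepOn.mono (AlgebraicIndepOn.insert (i := (i, e)) ih h) ?_
      rintro ⟨j, k⟩ (hp | hp)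
      · exact Or.inr (Or.inl hp)
      · obtain ⟨rfl, hk⟩ := hp
        rcases Nat.lt_succ_iff_lt_or_eq.mp hk with hk | hk
        · exact Or.inr (Or.inr ⟨rfl, hk⟩)
        · exact Or.inl (Prod.ext rfl hk)
  apply hdep
  refine algebraicIndependent_of_finite_type fun t ht => ?_
  obtain ⟨N, hN⟩ := ((ht.image fun p => p.1.2).bddAbove)
  let g : t → {p : ι × ℕ | p.1 ∈ T ∧ p.2 ≤ N ∨ p.1 = i ∧ p.2 < N + 1} := fun q =>
    ⟨q.1.1, by
      have h1 : q.1.1.2 ≤ N := hN ⟨q.1, q.2, rfl⟩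
      rcases Finset.mem_insert.mp q.1.2 with h | h
      · exact Or.inr ⟨h, Nat.lt_succ_of_le h1⟩
      · exact Or.inl ⟨h, h1⟩⟩
  have hg : Function.Injective g := fun x y hxy =>
    Subtype.ext (Subtype.ext (congrArg (fun z => z.1) hxy))
  exact (step N (N + 1)).comp g hg

open AlgebraicIndependent in
theorem Subfield.exists_iterate_mem_matroid_closure_add [CharZero E] (D : Derivation ℤ E E)
    (F : Subfield E) (hF : ∀ x ∈ F, D x ∈ F) {ι : Type*} (a : ι → E) {T : Finset ι}
    (hT : DiffIndep D F (fun j : T => a j))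
    (hdep : ∀ S : Finset ι, S.card = T.card + 1 → ¬ DiffIndep D F (fun j : S => a j)) (i : ι) :
    ∃ m e : ℕ, ∀ k N : ℕ, k ≤ N → D^[k] (a i) ∈ (matroid F E).closure
      ((fun p : ι × ℕ => D^[p.2] (a p.1)) ''
        {p | p.1 ∈ T ∧ p.2 ≤ m + N ∨ p.1 = i ∧ p.2 < e}) := by
  classical
  have hsub : ∀ s : Set E, s ⊆ (matroid F E).closure s := fun s =>
    Matroid.subset_closure _ _ (Set.subset_univ _)
  by_cases hi : i ∈ T
  · refine ⟨0, 0, fun k N hk => hsub _ ⟨(i, k), Or.inl ⟨hi, ?_⟩, rfl⟩⟩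
    simpa using hk
  obtain ⟨m, e, hme⟩ := exists_iterate_mem_matroid_closure D F a hi hT
    (hdep _ (Finset.card_insert_of_notMem hi))
  set f : ι × ℕ → E := fun p => D^[p.2] (a p.1) with hf
  refine ⟨m, e, ?_⟩
  set B : ℕ → Set E := fun N => f '' {p | p.1 ∈ T ∧ p.2 ≤ m + N ∨ p.1 = i ∧ p.2 < e} with hB
  have hBmono : ∀ N, B N ⊆ B (N + 1) := fun N => by
    apply Set.image_mono
    rintro p (hp | hp)
    · exact Or.inl ⟨hp.1, by have := hp.2; omega⟩
    · exact Or.inr hp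
  have hB0 : ∀ N, D^[e] (a i) ∈ (matroid F E).closure (B N) := fun N => by
    refine Matroid.closure_subset_closure _ (Set.image_mono ?_) hme
    rintro p (hp | hp)
    · exact Or.inl ⟨hp.1, by have := hp.2; omega⟩
    · exact Or.inr hp
  have hDB : ∀ N, ∀ y ∈ B N, D y ∈ (matroid F E).closure (B (N + 1)) := by
    rintro N _ ⟨⟨j, k⟩, hp, rfl⟩
    simp only [Set.mem_ofPred_eq, hf] at hp ⊢
    rw [← Function.iterate_succ_apply' D]
    rcases hp with hp | ⟨rfl, hk⟩
    · exact hsub _ ⟨(j, k + 1), Or.inl ⟨hp.1, by have := hp.2; simp only; omega⟩, rfl⟩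
    · rcases (Nat.succ_le_of_lt hk).lt_or_eq with hk | hk
      · exact hsub _ ⟨(j, k + 1), Or.inr ⟨rfl, hk⟩, rfl⟩
      · rw [hk]
        exact hB0 _
  have main : ∀ N k, k ≤ e + N → D^[k] (a i) ∈ (matroid F E).closure (B N) := by
    intro N
    induction N with
    | zero =>
      intro k hk
      rcases hk.lt_or_eq with hk | hk
      · exact hsub _ ⟨(i, k), Or.inr ⟨rfl, hk⟩, rfl⟩
      · rw [hk]
        exact hB0 0
    | succ N ih =>
      intro k hk
      rcases hk.lt_or_eq with hk | hk
      · exact Matroid.closure_subset_closure _ (hBmono N) (ih k (by omega))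
      · rw [hk, ← add_assoc, Function.iterate_succ_apply']
        exact F.derivation_mem_matroid_closure D hF ((hBmono N).trans (hsub _)) (hDB N)
          (ih _ le_rfl)
  exact fun k N hk => main N k (by omega)

end

theorem not_diffIndep_of_linear_combination {E : Type*} [Field E] [CharZero E] (δ : E → E)
    (hδadd : ∀ a b : E, δ (a + b) = δ a + δ b)
    (hδmul : ∀ a b : E, δ (a * b) = a * δ b + δ a * b)
    {F K : Subfield E} (hF : ∀ x ∈ F, δ x ∈ F) (hFK : F ≤ K)
    {n d : ℕ} (ξ : Fin n → E) (T : Finset (Fin n)) (hTcard : T.card = d)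
    (hTindep : DiffIndep δ F (fun i : T => ξ i))
    (hdep : ∀ S : Finset (Fin n), S.card = d + 1 → ¬ DiffIndep δ F (fun i : S => ξ i))
    (u : Fin (d + 1) → Fin n → E) (huK : ∀ σ ρ k, δ^[k] (u σ ρ) ∈ K)
    (ζ : Fin (d + 1) → E) (hζ : ∀ σ, ζ σ = -∑ ρ : Fin n, u σ ρ * ξ ρ) :
    ¬ DiffIndep δ K ζ := by
  classical
  intro hind
  let D : Derivation ℤ E E := Derivation.mk' (AddMonoidHom.mk' δ hδadd).toIntLinearMap
    (fun a b => (hδmul a b).trans (by simp [mul_comm]))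
  subst hTcard
  choose m e hme using Subfield.exists_iterate_mem_matroid_closure_add D F hF ξ hTindep hdep
  obtain ⟨M, hM⟩ := Finite.bddAbove_range m
  obtain ⟨e₀, he₀⟩ := Finite.bddAbove_range e
  set f : Fin n × ℕ → E := fun p => δ^[p.2] (ξ p.1) with hf
  set N := T.card * M + n * e₀ with hN
  set Y : Finset E := (T ×ˢ Finset.range (M + N + 1) ∪
    Finset.univ ×ˢ Finset.range e₀).image f with hY
  have hξ : ∀ i k, k ≤ N → δ^[k] (ξ i) ∈ (AlgebraicIndependent.matroid K E).closure Y := by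
    intro i k hk
    refine F.matroid_closure_mono hFK _ (Matroid.closure_subset_closure _ ?_ (hme i k N hk))
    rintro _ ⟨p, hp, rfl⟩
    have h1 : m i ≤ M := hM ⟨i, rfl⟩
    have h2 : e i ≤ e₀ := he₀ ⟨i, rfl⟩
    rw [hY, Finset.coe_image]
    refine ⟨p, ?_, rfl⟩
    simp only [Finset.coe_union, Finset.coe_product, Set.mem_union, Set.mem_prod, Finset.mem_coe,
      Finset.mem_range, Finset.mem_univ, true_and]
    rcases hp with hp | hp
    · exact Or.inl ⟨hp.1, by have := hp.2; omega⟩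
    · exact Or.inr (by have := hp.2; omega)
  obtain ⟨L, hL, hKL⟩ := K.exists_coe_eq_matroid_closure (Y : Set E)
  rw [← hL] at hξ
  let g : Fin (T.card + 1) × Fin (N + 1) → E := fun p => δ^[p.2] (ζ p.1)
  have hg : AlgebraicIndependent K g :=
    hind.comp (fun p : Fin (T.card + 1) × Fin (N + 1) => (p.1, (p.2 : ℕ)))
      (fun p q h => Prod.ext (Prod.ext_iff.mp h).1 (Fin.ext (Prod.ext_iff.mp h).2))
  have hgY : Set.range g ⊆ (AlgebraicIndependent.matroid K E).closure Y := by
    rintro _ ⟨⟨σ, k⟩, rfl⟩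
    rw [← hL]
    simp only [g, hζ]
    rw [iterate_neg_sum_mul δ hδadd hδmul]
    refine neg_mem (sum_mem fun ρ _ => sum_mem fun p hp => ?_)
    have hp := Finset.HasAntidiagonal.mem_antidiagonal.mp hp
    exact mul_mem (natCast_mem L _) (mul_mem (hKL (huK σ ρ p.1)) (hξ ρ p.2 (by omega)))
  have hcard := K.encard_le_of_subset_matroid_closure hg.to_subtype_range hgY
  rw [Set.encard_coe_eq_coe_finsetCard, ← Set.image_univ, hg.injective.encard_image,
    Set.encard_univ, ENat.card_eq_coe_fintype_card, Nat.cast_le, Fintype.card_prod,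
    Fintype.card_fin, Fintype.card_fin] at hcard
  have h1 : Y.card ≤ T.card * (M + N + 1) + n * e₀ := by
    refine Finset.card_image_le.trans ((Finset.card_union_le _ _).trans ?_)
    simp
  nlinarith

theorem diffIndep_linear_combination {E : Type*} [Field E] (δ : E → E)
    (hδadd : ∀ a b : E, δ (a + b) = δ a + δ b)
    (hδmul : ∀ a b : E, δ (a * b) = a * δ b + δ a * b)
    (F : Subfield E) {n d : ℕ} (ξ : Fin n → E) (T : Finset (Fin n)) (hTcard : T.card = d)
    (hTindep : DiffIndep δ F (fun i : T => ξ i))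
    (u : Fin (d + 1) → Fin n → E)
    (hu : DiffIndep δ (diffAdjoin δ F (Set.range ξ))
      (fun p : Fin (d + 1) × Fin n => u p.1 p.2))
    (ζ : Fin (d + 1) → E) (hζ : ∀ σ, ζ σ = -∑ ρ : Fin n, u σ ρ * ξ ρ) :
    DiffIndep δ (diffAdjoin δ F {x | ∃ σ ρ, u σ ρ = x}) (fun σ : Fin d => ζ σ.succ) := by
  set L := diffAdjoin δ F (Set.range ξ)
  have hFL : F ≤ L := fun x hx => Subfield.subset_closure (Or.inl hx)
  have hξL : ∀ ρ k, δ^[k] (ξ ρ) ∈ L := fun ρ k =>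
    Subfield.subset_closure (Or.inr ⟨ξ ρ, ⟨ρ, rfl⟩, k, rfl⟩)
  let _ : Algebra F L := (Subfield.inclusion hFL).toAlgebra
  have : IsScalarTower F L E := .of_algebraMap_eq fun _ => rfl
  let e : Fin d ≃ T := (T.equivFinOfCardEq hTcard).symm
  let U : (Fin (d + 1) × Fin n) × ℕ → E := fun p => δ^[p.2] (u p.1.1 p.1.2)
  let c : (Fin (d + 1) × Fin n) × ℕ → F := fun p =>
    Fin.cases 0 (fun s => if p.1.2 = e s then if p.2 = 0 then -1 else 0 else 0) p.1.1
  let Z : Fin d × ℕ → MvPolynomial ((Fin (d + 1) × Fin n) × ℕ) L := fun q =>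
    -∑ ρ : Fin n, ∑ p ∈ Finset.HasAntidiagonal.antidiagonal q.2,
      (q.2.choose p.1 : MvPolynomial _ L) *
        (MvPolynomial.X ((q.1.succ, ρ), p.1) * MvPolynomial.C ⟨δ^[p.2] (ξ ρ), hξL ρ p.2⟩)
  have hZU : ∀ q, MvPolynomial.aeval U (Z q) = δ^[q.2] (ζ q.1.succ) := by
    intro q
    rw [hζ, iterate_neg_sum_mul δ hδadd hδmul]
    simp only [Z, map_neg, map_sum, map_mul, map_natCast, MvPolynomial.aeval_X,
      MvPolynomial.aeval_C]
    rfl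
  have hZc : ∀ q, MvPolynomial.eval (fun i => algebraMap F L (c i)) (Z q) =
      ⟨δ^[q.2] (ξ (e q.1)), hξL _ _⟩ := by
    intro q
    simp only [Z, map_neg, map_sum, map_mul, map_natCast, MvPolynomial.eval_X,
      MvPolynomial.eval_C, c, Fin.cases_succ]
    rw [Finset.sum_eq_single (e q.1 : Fin n), Finset.sum_eq_single (0, q.2)]
    · simp
    · rintro ⟨i, j⟩ hp hne
      have hp := Finset.HasAntidiagonal.mem_antidiagonal.mp hp
      have hi : i ≠ 0 := by
        rintro rfl
        exact hne (Prod.ext rfl (by simpa using hp))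
      simp [hi]
    · intro h
      exact absurd (Finset.HasAntidiagonal.mem_antidiagonal.mpr (zero_add _)) h
    · intro ρ _ hρ
      simp [hρ]
    · simp
  have hc : AlgebraicIndependent F
      (fun q => MvPolynomial.eval (fun i => algebraMap F L (c i)) (Z q)) := by
    simp only [hZc]
    rw [← (IsScalarTower.toAlgHom F L E).algebraicIndependent_iff Subtype.val_injective]
    exact hTindep.comp (Prod.map e id) (e.injective.prodMap Function.injective_id)
  have hU : Function.Injective ((MvPolynomial.aeval U).restrictScalars F :
      MvPolynomial ((Fin (d + 1) × Fin n) × ℕ) L →ₐ[F] E) :=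
    algebraicIndependent_iff_injective_aeval.mp hu
  have hUZ : AlgebraicIndependent F
      (Sum.elim (fun q : Fin d × ℕ => δ^[q.2] (ζ q.1.succ)) U) := by
    have h := ((AlgebraicIndependent.sumElim_X_of_eval Z c hc).map' hU).comp _
      Sum.swap_leftInverse.injective
    convert h using 1
    funext i
    rcases i with q | p
    · exact (hZU q).symm
    · exact (MvPolynomial.aeval_X U p).symm
  have hK : diffAdjoin δ F {x | ∃ σ ρ, u σ ρ = x} =
      (IntermediateField.adjoin F (Set.range U)).toSubfield := by
    have h : Set.range (algebraMap F E) = (F : Set E) := Subtype.range_coe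
    change _ = Subfield.closure (Set.range (algebraMap F E) ∪ Set.range U)
    rw [diffAdjoin, h]
    congr 2
    ext x
    constructor
    · rintro ⟨_, ⟨σ, ρ, rfl⟩, k, rfl⟩
      exact ⟨((σ, ρ), k), rfl⟩
    · rintro ⟨⟨⟨σ, ρ⟩, k⟩, rfl⟩
      exact ⟨_, ⟨σ, ρ, rfl⟩, k, rfl⟩
  rw [hK]
  exact IntermediateField.algebraicIndependent_adjoin_iff.mpr
    (AlgebraicIndependent.sumElim_iff.mp hUZ).2

/-- **Differential transcendence degree of the coordinates of the Chow form.**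
Let `ξ = (ξ₁,…,ξₙ)` have differential transcendence degree `d` over `F`, let
`u_{σρ}` (`0 ≤ σ ≤ d`, `1 ≤ ρ ≤ n`) be differentially independent over
`F⟨ξ₁,…,ξₙ⟩`, set `ζ_σ = −∑_ρ u_{σρ} ξ_ρ`, and `K = F⟨u_{σρ}⟩`.  Then
`ζ₀,…,ζ_d` are differentially dependent over `K`, and if `d > 0` then
`ζ₁,…,ζ_d` are differentially independent over `K`. -/
theorem chow_coordinates_diff_transcendence
    {E : Type*} [Field E] [CharZero E] (δ : E → E)
    (hδadd : ∀ a b : E, δ (a + b) = δ a + δ b)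
    (hδmul : ∀ a b : E, δ (a * b) = a * δ b + δ a * b)
    (F : Subfield E) (hF : ∀ x ∈ F, δ x ∈ F)
    (n d : ℕ) (ξ : Fin n → E)
    (T : Finset (Fin n)) (hTcard : T.card = d)
    (hTindep : DiffIndep δ F (fun i : T => ξ i))
    (hdep : ∀ S : Finset (Fin n), S.card = d + 1 → ¬ DiffIndep δ F (fun i : S => ξ i))
    (u : Fin (d + 1) → Fin n → E)
    (hu : DiffIndep δ (diffAdjoin δ F (Set.range ξ))
      (fun p : Fin (d + 1) × Fin n => u p.1 p.2))
    (ζ : Fin (d + 1) → E) (hζ : ∀ σ, ζ σ = -∑ ρ : Fin n, u σ ρ * ξ ρ) :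
    ¬ DiffIndep δ (diffAdjoin δ F {x | ∃ σ ρ, u σ ρ = x}) ζ ∧
      (0 < d → DiffIndep δ (diffAdjoin δ F {x | ∃ σ ρ, u σ ρ = x})
        (fun σ : Fin d => ζ σ.succ)) := by
  refine ⟨not_diffIndep_of_linear_combination δ hδadd hδmul hF
    (fun x hx => Subfield.subset_closure (Or.inl hx)) ξ T hTcard hTindep hdep u
    (fun σ ρ k => Subfield.subset_closure (Or.inr ⟨_, ⟨σ, ρ, rfl⟩, k, rfl⟩)) ζ hζ, fun _ => ?_⟩
  exact diffIndep_linear_combination δ hδadd hδmul F ξ T hTcard hTindep u hu ζ hζ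
end
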